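/- arXiv:2504.13046 — 2 statements merged into one kernel-verified Lean document; each statement's English description precedes it below -/
import Mathlib

section
/- Under exactly the hypotheses of the main rate theorem for VFOSA₊ (FBS setting, parameter choices, VR(Δ_k; κ_k, Θ_k, σ_k) property and the Γ_k-conditions), assume additionally 0 < β < (2 − μ)β̄/(2 + μ) strictly and B_∞ := (Λ/β)∑_{k=0}^{∞} t_{k−1}(t_{k−1} − 1)σ_k²/Θ_k < ∞. Then: (a) for all k ≥ 0, E‖G_λ x^k‖² ≤ 2(Ψ₀² + E₀² + B_∞)/(μ²(k + r − 1)²); (b) ∑_{k=0}^{∞}(k + 1)·E‖G_λ x^k‖² < ∞, ∑_{k=0}^{∞}(k + 1)²·E‖F̃^k − F x^k‖² < ∞, and ∑_{k=0}^{∞}(k + 1)·E‖x^{k+1} − x^k‖² < ∞; (c) lim_{k→∞} k²·E‖x^{k+1} − x^k‖² = 0 and lim_{k→∞} k²·E‖G_λ x^k‖² = 0. Here Ψ₀² := μ²r²‖G_λ x^0‖² + ((2r − 1)/(4β²(μr − 1)))‖x^0 − x⋆‖² and E₀² := (μ r²(Γ₀μ + β)/(2β))σ₀². -/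
open MeasureTheory Filter
open scoped RealInnerProductSpace Pointwise

section Operators

variable {E : Type*} [NormedAddCommGroup E] [InnerProductSpace ℝ E]

lemma exists_smul_eq_of_resolvent {lam : ℝ} {T : E → Set E} {J : E → E}
    (hJ : ∀ a, a - J a ∈ lam • T (J a)) (a : E) : ∃ u ∈ T (J a), a - J a = lam • u := by
  obtain ⟨u, hu, h⟩ := Set.mem_smul_set.mp (hJ a)
  exact ⟨u, hu, h.symm⟩

lemma resolvent_nonexpansive {ρ lam : ℝ} (hlam : 0 < lam) (hρ : 2 * ρ ≤ lam)
    {T : E → Set E}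
    (hT : ∀ a b u v, u ∈ T a → v ∈ T b → ⟪u - v, a - b⟫ ≥ -ρ * ‖u - v‖ ^ 2)
    {J : E → E} (hJ : ∀ a, a - J a ∈ lam • T (J a)) (a b : E) :
    ‖J a - J b‖ ≤ ‖a - b‖ := by
  obtain ⟨u, hu, hau⟩ := exists_smul_eq_of_resolvent hJ a
  obtain ⟨v, hv, hbv⟩ := exists_smul_eq_of_resolvent hJ b
  have h := hT _ _ u v hu hv
  have hab : a - b = (J a - J b) + lam • (u - v) := by
    rw [smul_sub, ← hau, ← hbv]; abel
  have hsq : ‖a - b‖ ^ 2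
      = ‖J a - J b‖ ^ 2 + 2 * lam * ⟪u - v, J a - J b⟫ + lam ^ 2 * ‖u - v‖ ^ 2 := by
    rw [hab, norm_add_sq_real, inner_smul_right, norm_smul, mul_pow, Real.norm_eq_abs, sq_abs,
      real_inner_comm]
    ring
  have h1 : 2 * lam * ⟪u - v, J a - J b⟫ ≥ 2 * lam * (-ρ * ‖u - v‖ ^ 2) :=
    mul_le_mul_of_nonneg_left h (by positivity)
  have h2 : 0 ≤ lam * (lam - 2 * ρ) * ‖u - v‖ ^ 2 :=
    mul_nonneg (mul_nonneg hlam.le (by linarith)) (sq_nonneg _)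
  exact le_of_sq_le_sq (by linarith) (norm_nonneg _)

lemma cocoercive_lipschitz {L : ℝ} (hL : 0 < L) {F : E → E}
    (hF : ∀ a b, ⟪F a - F b, a - b⟫ ≥ (1 / L) * ‖F a - F b‖ ^ 2) (a b : E) :
    ‖F a - F b‖ ≤ L * ‖a - b‖ := by
  have h1 := hF a b
  have h2 := real_inner_le_norm (F a - F b) (a - b)
  rcases (norm_nonneg (F a - F b)).eq_or_lt with h | h
  · rw [← h]; positivity
  · have h3 : ‖F a - F b‖ * ((1 / L) * ‖F a - F b‖) ≤ ‖F a - F b‖ * ‖a - b‖ := by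
      nlinarith
    have h4 := le_of_mul_le_mul_left h3 h
    rw [one_div, inv_mul_le_iff₀ hL] at h4
    exact h4

lemma forwardBackward_cocoercive {L ρ Lhat lam : ℝ}
    (hL : 0 < L) (hLhat : L < Lhat) (hLhatρ : Lhat * ρ < 1) (hlam : 0 < lam)
    {F : E → E} (hF : ∀ a b, ⟪F a - F b, a - b⟫ ≥ (1 / L) * ‖F a - F b‖ ^ 2)
    {T : E → Set E}
    (hT : ∀ a b u v, u ∈ T a → v ∈ T b → ⟪u - v, a - b⟫ ≥ -ρ * ‖u - v‖ ^ 2)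
    {J : E → E} (hJ : ∀ a, a - J a ∈ lam • T (J a))
    {G : E → E} (hG : ∀ a, G a = (1 / lam) • (a - J (a - lam • F a))) (a b : E) :
    (lam * (4 - Lhat * lam) - 4 * ρ) / (4 * (1 - ρ * Lhat)) * ‖G a - G b‖ ^ 2
        + (Lhat - L) / (L * Lhat) * (L * ⟪F a - F b, a - b⟫) ≤ ⟪G a - G b, a - b⟫ := by
  have hLh : 0 < Lhat := hL.trans hLhat
  have hJG : ∀ c, J (c - lam • F c) = c - lam • G c := by
    intro c
    rw [hG, smul_smul, mul_one_div_cancel hlam.ne', one_smul]; abel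
  have hmem : ∀ c, G c - F c ∈ T (c - lam • G c) := by
    intro c
    obtain ⟨u, hu, h⟩ := exists_smul_eq_of_resolvent hJ (c - lam • F c)
    rw [hJG] at hu h
    have : lam • (G c - F c) = lam • u := by rw [← h, smul_sub]; abel
    rwa [smul_right_injective E hlam.ne' this]
  have h := hT _ _ _ _ (hmem a) (hmem b)
  have hFab := hF a b
  set u := G a - G b
  set f := F a - F b
  set d := a - b
  have e1 : G a - F a - (G b - F b) = u - f := by simp only [u, f]; abel
  have e2 : a - lam • G a - (b - lam • G b) = d - lam • u := by
    simp only [u, d, smul_sub]; abel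
  rw [e1, e2, norm_sub_sq_real] at h
  simp only [inner_sub_left, inner_sub_right, inner_smul_right, real_inner_self_eq_norm_sq] at h
  rw [real_inner_comm u f] at h
  have hden : 0 < 1 - ρ * Lhat := by linarith [mul_comm ρ Lhat]
  have hq : 0 ≤ 1 / (4 * Lhat * (1 - ρ * Lhat))
      * ‖(Lhat * (lam - 2 * ρ)) • u - (2 * (1 - ρ * Lhat)) • f‖ ^ 2 := by positivity
  rw [norm_sub_sq_real, inner_smul_left, inner_smul_right, norm_smul, norm_smul, mul_pow, mul_pow,
    Real.norm_eq_abs, Real.norm_eq_abs, sq_abs, sq_abs] at hq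
  simp only [RCLike.conj_to_real] at hq
  have hq' : 0 ≤ Lhat * (lam - 2 * ρ) ^ 2 / (4 * (1 - ρ * Lhat)) * ‖u‖ ^ 2
      - (lam - 2 * ρ) * ⟪u, f⟫ + (1 / Lhat - ρ) * ‖f‖ ^ 2 := by
    refine hq.trans_eq ?_
    obtain ⟨w, hw⟩ : ∃ w, w = 1 - ρ * Lhat := ⟨_, rfl⟩
    have hf : 1 / Lhat - ρ = w / Lhat := by rw [hw]; field_simp
    rw [← hw] at hden
    rw [hf, ← hw]
    field_simp
    ring
  have hk : (lam * (4 - Lhat * lam) - 4 * ρ) / (4 * (1 - ρ * Lhat)) * ‖u‖ ^ 2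
      = (lam - ρ) * ‖u‖ ^ 2 - Lhat * (lam - 2 * ρ) ^ 2 / (4 * (1 - ρ * Lhat)) * ‖u‖ ^ 2 := by
    rw [← sub_mul]
    congr 1
    rw [div_eq_iff (by positivity), sub_mul, div_mul_cancel₀ _ (by positivity)]
    ring
  have hk2 : (Lhat - L) / (L * Lhat) * (L * ⟪f, d⟫) = ⟪f, d⟫ - L / Lhat * ⟪f, d⟫ := by
    field_simp
  have hk3 : 1 / Lhat * ‖f‖ ^ 2 ≤ L / Lhat * ⟪f, d⟫ := by
    have := mul_le_mul_of_nonneg_left hFab (show 0 ≤ L / Lhat by positivity)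
    refine le_trans (le_of_eq ?_) this
    field_simp
  rw [hk, hk2]
  linarith

end Operators

section Coefficients

lemma step_size_bounds {μ β t : ℝ} (hμ0 : 0 < μ) (hμ1 : μ < 2 / 3) (hβ : 0 < β)
    (ht : 1 + 2 * μ ≤ t) :
    0 < 2 * β * (t - 1) / (t - μ / 2) ∧ 2 * β * (t - 1) / (t - μ / 2) ≤ 2 * β := by
  have h1 : 0 < t - 1 := by linarith
  have h2 : 0 < t - μ / 2 := by linarith
  refine ⟨by positivity, ?_⟩
  rw [div_le_iff₀ h2]
  exact mul_le_mul_of_nonneg_left (by linarith) (by positivity)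

lemma step_size_gap {μ β t : ℝ} (hμ0 : 0 < μ) (hμ1 : μ < 2 / 3) (hβ : 0 < β)
    (ht : 1 + 2 * μ ≤ t) :
    0 ≤ t * (t - 1) * (2 * β - 2 * β * (t - 1) / (t - μ / 2)) ∧
      t * (t - 1) * (2 * β - 2 * β * (t - 1) / (t - μ / 2)) ≤ 2 * β * t := by
  have h1 : 0 < t - 1 := by linarith
  have h2 : 0 < t - μ / 2 := by linarith
  have hb := (step_size_bounds hμ0 hμ1 hβ ht).2
  refine ⟨mul_nonneg (mul_nonneg (by linarith) h1.le) (by linarith), ?_⟩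
  have : t * (t - 1) * (2 * β - 2 * β * (t - 1) / (t - μ / 2))
      = 2 * β * t * ((t - 1) * (1 - μ / 2) / (t - μ / 2)) := by
    generalize hw : t - μ / 2 = w at h2
    field_simp
    rw [← hw]
    ring
  rw [this]
  have h3 : (t - 1) * (1 - μ / 2) / (t - μ / 2) ≤ 1 := by
    rw [div_le_one h2]
    nlinarith
  exact mul_le_of_le_one_right (mul_nonneg (by positivity) (by linarith)) h3

lemma residual_coefficient_le {μ β βbar t : ℝ} (hμ0 : 0 < μ) (hμ1 : μ < 2 / 3) (hβ : 0 < β)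
    (hβbar : (2 + μ) / (2 - μ) * β ≤ βbar) (ht : 1 + 2 * μ ≤ t) :
    t * (t - 1) * (2 * β * (t - 1) / (t - μ / 2) - β) - β * (t - μ) * (t - μ - 1) - βbar
        + (μ * (1 - μ / 2) * β * t / (t - μ / 2)
          + μ / 2 * (2 * β * (t - 1) / (t - μ / 2)) / 2)
      ≤ -(β / 2) - β * (2 - 3 * μ) / 8 * t := by
  have h2 : 0 < t - μ / 2 := by linarith
  have h3 : 0 < 2 - μ := by linarith
  obtain ⟨u, rfl⟩ : ∃ u, t = 1 + 2 * μ + u := ⟨t - (1 + 2 * μ), by ring⟩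
  have hu : 0 ≤ u := by linarith
  have hm : 0 < 2 - 3 * μ := by linarith
  refine le_trans (add_le_add_left (sub_le_sub_left hβbar _) _) ?_
  rw [← sub_nonpos]
  set t := 1 + 2 * μ + u with ht'
  have key : t * (t - 1) * (2 * β * (t - 1) / (t - μ / 2) - β) - β * (t - μ) * (t - μ - 1)
        - (2 + μ) / (2 - μ) * β
        + (μ * (1 - μ / 2) * β * t / (t - μ / 2)
          + μ / 2 * (2 * β * (t - 1) / (t - μ / 2)) / 2)
      - (-(β / 2) - β * (2 - 3 * μ) / 8 * t)
      = β * ((t * (t - 1) * (2 * (t - 1) - (t - μ / 2)) - (t - μ) * (t - μ - 1) * (t - μ / 2)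
        + μ * (1 - μ / 2) * t + μ / 2 * (t - 1)
        + (1 / 2 + (2 - 3 * μ) / 8 * t) * (t - μ / 2)) * (2 - μ)
        - (2 + μ) * (t - μ / 2)) / ((t - μ / 2) * (2 - μ)) := by
    generalize hw : t - μ / 2 = w at h2
    field_simp
    rw [← hw]
    ring
  rw [key]
  refine div_nonpos_of_nonpos_of_nonneg (mul_nonpos_of_nonneg_of_nonpos hβ.le ?_) (by positivity)
  rw [ht']
  have a1 := mul_pos hμ0 hm
  have a2 := mul_nonneg hu hm.le
  have a3 := mul_nonneg hu hu
  have a4 := mul_nonneg hu hμ0.le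
  have a5 := mul_nonneg a3 hm.le
  have a6 := mul_nonneg a4 hm.le
  have a7 := mul_nonneg a3 hμ0.le
  nlinarith [mul_pos hμ0 hμ0, mul_pos a1 hμ0, mul_pos a1 hm, mul_pos (mul_pos hμ0 hμ0) hμ0, mul_nonneg a6 hμ0.le, mul_nonneg a7 hm.le, mul_nonneg a5 hm.le, mul_nonneg a6 hm.le, mul_pos (mul_pos a1 hμ0) hμ0, mul_pos (mul_pos a1 hm) hμ0,  mul_nonneg (mul_nonneg a6 hμ0.le) hμ0.le]

lemma squared_cross_coefficient_le {μ β t : ℝ} (hμ0 : 0 < μ) (hμ1 : μ < 2 / 3) (hβ : 0 < β)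
    (ht : 1 + 2 * μ ≤ t) :
    (2 * β * (1 - μ / 2) * t * (t - 1 - μ) / (t - μ / 2)) ^ 2 / (2 * β)
      ≤ β * (2 - μ) ^ 2 / 2 * (t * (t - 1)) := by
  have h2 : 0 < t - μ / 2 := by linarith
  have h3 : 0 ≤ t - 1 - μ := by linarith
  have h4 : t * (t - 1) ≤ (t - μ / 2) ^ 2 := by nlinarith
  have h5 : (t - 1 - μ) ^ 2 ≤ (t - 1) ^ 2 := by nlinarith
  have h6 : t ^ 2 * (t - 1 - μ) ^ 2 ≤ t * (t - 1) * (t - μ / 2) ^ 2 := by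
    calc t ^ 2 * (t - 1 - μ) ^ 2 ≤ t ^ 2 * (t - 1) ^ 2 := by gcongr
      _ = t * (t - 1) * (t * (t - 1)) := by ring
      _ ≤ t * (t - 1) * (t - μ / 2) ^ 2 :=
        mul_le_mul_of_nonneg_left h4 (mul_nonneg (by linarith) (by linarith))
  have h7 : t ^ 2 * (t - 1 - μ) ^ 2 / (t - μ / 2) ^ 2 ≤ t * (t - 1) := by
    rw [div_le_iff₀ (by positivity)]
    exact h6
  have h8 : (2 * β * (1 - μ / 2) * t * (t - 1 - μ) / (t - μ / 2)) ^ 2 / (2 * β)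
      = β * (2 - μ) ^ 2 / 2 * (t ^ 2 * (t - 1 - μ) ^ 2 / (t - μ / 2) ^ 2) := by
    generalize t - μ / 2 = w at h2
    field_simp
  rw [h8]
  exact mul_le_mul_of_nonneg_left h7 (by positivity)

lemma noise_square_coefficient_le {μ β t : ℝ} (hμ0 : 0 < μ) (hμ1 : μ < 2 / 3) (hβ : 0 < β)
    (ht : 1 + 2 * μ ≤ t) :
    μ * (1 - μ / 2) * β * t / (t - μ / 2) - μ / 2 * (2 * β * (t - 1) / (t - μ / 2)) / 2
      ≤ β / 2 * (t * (t - 1)) := by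
  have h2 : 0 < t - μ / 2 := by linarith
  have h3 : μ * (1 - μ / 2) * β * t / (t - μ / 2) - μ / 2 * (2 * β * (t - 1) / (t - μ / 2)) / 2
      = β / 2 * (μ * ((1 - μ) * t + 1) / (t - μ / 2)) := by
    generalize hw : t - μ / 2 = w at h2
    field_simp
    ring
  rw [h3]
  refine mul_le_mul_of_nonneg_left ?_ (by positivity)
  rw [div_le_iff₀ h2]
  have h4 : (1 - μ) * t + 1 ≤ t * (2 * t - μ) := by nlinarith
  have h5 : 0 ≤ t * (2 * t - μ) := mul_nonneg (by linarith) (by linarith)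
  nlinarith

lemma shift_weight_bound {μ β t a X : ℝ} (hμ0 : 0 < μ) (hμ1 : μ < 2 / 3) (hβ : 0 < β)
    (ht : 1 + 2 * μ ≤ t)
    (ha : a = μ * t * (2 * t - μ) / (4 * β * (2 - μ) * (t - 1) ^ 2))
    (hX : X = β * (μ * (2 - μ) / 4) * (t * (t - 1))) :
    μ ^ 2 ≤ 4 * (a * (1 - ((t - 1) / t) ^ 2)) * X := by
  have h1 : 0 < t - 1 := by linarith
  have h0 : 0 < t := by linarith
  have h3 : 0 < 2 - μ := by linarith
  have h : 4 * (a * (1 - ((t - 1) / t) ^ 2)) * X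
      = μ ^ 2 * (((2 * t - μ) * (2 * t - 1)) / (4 * (t - 1))) := by
    rw [ha, hX]
    generalize hw : t - 1 = w at h1
    generalize 2 - μ = v at h3
    field_simp
    rw [← hw]
    ring
  rw [h]
  refine le_mul_of_one_le_right (by positivity) ?_
  rw [one_le_div (by positivity)]
  nlinarith

lemma total_noise_coefficient_le {μ : ℝ} (hμ0 : 0 < μ) (hμ1 : μ < 2 / 3) :
    (2 - μ) / (2 * μ) + 1 / 2 + (2 - μ) ^ 2 / 2 + μ * (2 - μ) / 4 + 1 / (2 - μ)
      ≤ 12 / (5 * μ) := by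
  have h3 : 0 < 2 - μ := by linarith
  have : 12 / (5 * μ) - ((2 - μ) / (2 * μ) + 1 / 2 + (2 - μ) ^ 2 / 2 + μ * (2 - μ) / 4
      + 1 / (2 - μ))
      = ((7 / 5 - μ * ((2 - μ) ^ 2 / 2 + μ * (2 - μ) / 4)) * (2 - μ) - μ) / (μ * (2 - μ)) := by
    field_simp
    ring
  have h4 : 0 ≤ (7 / 5 - μ * ((2 - μ) ^ 2 / 2 + μ * (2 - μ) / 4)) * (2 - μ) - μ := by
    nlinarith [mul_pos hμ0 h3, sq_nonneg (μ - 2 / 3), sq_nonneg (μ - 1 / 2),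
      mul_pos (mul_pos hμ0 h3) h3, mul_pos hμ0 (sub_pos.2 hμ1), mul_nonneg hμ0.le (sq_nonneg (μ - 2 / 3))]
  have h5 := div_nonneg h4 (mul_pos hμ0 h3).le
  linarith

end Coefficients

section Step

variable {E : Type*} [NormedAddCommGroup E] [InnerProductSpace ℝ E]

lemma inexact_step_correlation {μ β βbar t η m : ℝ} (hμ0 : 0 < μ) (hμ1 : μ < 2 / 3) (hβ : 0 < β)
    (hβbar : (2 + μ) / (2 - μ) * β ≤ βbar) (ht : 1 ≤ t)
    {d p p' g g' e : E}
    (h1 : (t - 1) • d = -p' - (2 * β * (t - 1)) • (g + e))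
    (h2 : t • d = -p - (t * η) • (g + e))
    (hM : βbar * ‖g' - g‖ ^ 2 + m ≤ ⟪g' - g, d⟫) :
    β * t * (t - 1) * ‖g'‖ ^ 2 + t * ⟪g', p'⟫ + t * (t - 1) * m
      ≤ (t - 1) * ⟪g, p⟫ + t * (t - 1) * (η - β) * ‖g‖ ^ 2
        - t * (t - 1) * (2 * β - η) * ⟪g, e⟫
        + β * (2 - μ) / (2 * μ) * (t * (t - 1)) * ‖e‖ ^ 2 := by
  have i1 : (t - 1) * ⟪g', d⟫ = -⟪g', p'⟫ - 2 * β * (t - 1) * (⟪g', g⟫ + ⟪g', e⟫) := by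
    rw [← inner_smul_right, h1, inner_sub_right, inner_neg_right, inner_smul_right,
      inner_add_right]
  have i2 : t * ⟪g, d⟫ = -⟪g, p⟫ - t * η * (‖g‖ ^ 2 + ⟪g, e⟫) := by
    rw [← inner_smul_right, h2, inner_sub_right, inner_neg_right, inner_smul_right,
      inner_add_right, real_inner_self_eq_norm_sq]
  have hμ2 : 0 < 2 - μ := by linarith
  have hs : βbar ≥ β + 2 * μ / (2 - μ) * β := by
    refine le_trans (le_of_eq ?_) hβbar
    field_simp
    ring
  have hy : 0 ≤ β * (2 - μ) / (2 * μ) * ‖(2 * μ / (2 - μ)) • (g' - g) + e‖ ^ 2 := by positivity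
  rw [norm_add_sq_real, inner_smul_left, norm_smul, mul_pow, Real.norm_eq_abs, sq_abs] at hy
  simp only [RCLike.conj_to_real] at hy
  have hy' : 0 ≤ 2 * μ / (2 - μ) * β * ‖g' - g‖ ^ 2 + 2 * β * ⟪g' - g, e⟫
      + β * (2 - μ) / (2 * μ) * ‖e‖ ^ 2 := by
    refine hy.trans_eq ?_
    field_simp
  have hs' := mul_le_mul_of_nonneg_right hs (sq_nonneg ‖g' - g‖)
  have hM' : β * ‖g' - g‖ ^ 2 + m ≤ ⟪g' - g, d⟫ + 2 * β * ⟪g' - g, e⟫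
      + β * (2 - μ) / (2 * μ) * ‖e‖ ^ 2 := by linarith
  have htt : 0 ≤ t * (t - 1) := mul_nonneg (by linarith) (by linarith)
  have hfin := mul_le_mul_of_nonneg_left hM' htt
  rw [norm_sub_sq_real, inner_sub_left, inner_sub_left] at hfin
  have j1 : t * (t - 1) * ⟪g', d⟫ = t * (-⟪g', p'⟫ - 2 * β * (t - 1) * (⟪g', g⟫ + ⟪g', e⟫)) := by
    rw [← i1]; ring
  have j2 : t * (t - 1) * ⟪g, d⟫ = (t - 1) * (-⟪g, p⟫ - t * η * (‖g‖ ^ 2 + ⟪g, e⟫)) := by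
    rw [← i2]; ring
  nlinarith

lemma young_inner_nonneg {α c X : ℝ} (hα : 0 < α) (hc : c ^ 2 ≤ 4 * α * X) (p e : E) :
    0 ≤ α * ‖p‖ ^ 2 + c * ⟪p, e⟫ + X * ‖e‖ ^ 2 := by
  have h : 0 ≤ 1 / α * ‖α • p + (c / 2) • e‖ ^ 2 := by positivity
  rw [norm_add_sq_real, inner_smul_left, inner_smul_right, norm_smul, norm_smul, mul_pow, mul_pow,
    Real.norm_eq_abs, Real.norm_eq_abs, sq_abs, sq_abs] at h
  simp only [RCLike.conj_to_real] at h
  have h2 : 0 ≤ 1 / α * ((4 * α * X - c ^ 2) / 4 * ‖e‖ ^ 2) := by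
    have : 0 ≤ 4 * α * X - c ^ 2 := by linarith
    positivity
  refine (add_nonneg h h2).trans_eq ?_
  field_simp
  ring

lemma norm_sq_contraction {θ : ℝ} (p q : E) (c : ℝ) :
    ‖θ • p - c • q‖ ^ 2 = θ ^ 2 * ‖p‖ ^ 2 - 2 * θ * c * ⟪p, q⟫ + c ^ 2 * ‖q‖ ^ 2 := by
  rw [norm_sub_sq_real, inner_smul_left, inner_smul_right, norm_smul, norm_smul, mul_pow, mul_pow,
    Real.norm_eq_abs, Real.norm_eq_abs, sq_abs, sq_abs]
  simp only [RCLike.conj_to_real]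
  ring

lemma lyapunov_step {μ β βbar t η m a a' C C' : ℝ} (hμ0 : 0 < μ) (hμ1 : μ < 2 / 3) (hβ : 0 < β)
    (hβbar : (2 + μ) / (2 - μ) * β ≤ βbar) (ht : 1 + 2 * μ ≤ t)
    (hη : η = 2 * β * (t - 1) / (t - μ / 2))
    (ha : a = μ * t * (2 * t - μ) / (4 * β * (2 - μ) * (t - 1) ^ 2)) (ha' : a' ≤ a)
    (hC : C = (2 * t - μ) / (4 * μ * β * (t - 1)))
    (hC' : C' = (2 * (t + μ) - μ) / (4 * μ * β * (t + μ - 1)))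
    {d p p' g g' e w w' : E}
    (h1 : (t - 1) • d = -p' - (2 * β * (t - 1)) • (g + e))
    (h2 : t • d = -p - (t * η) • (g + e))
    (hp' : p' = ((t - 1) / t) • p - ((1 - μ / 2) * η) • (g + e))
    (hw' : w' = w - (μ / 2 * η) • (g + e))
    (hM : βbar * ‖g' - g‖ ^ 2 + m ≤ ⟪g' - g, d⟫)
    (hG : βbar * ‖g‖ ^ 2 ≤ ⟪g, p + w⟫) :
    β * t * (t - 1) * ‖g'‖ ^ 2 + t * ⟪g', p'⟫ + a' * ‖p'‖ ^ 2 + C' * ‖w'‖ ^ 2 + t * (t - 1) * m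
      ≤ β * (t - μ) * (t - μ - 1) * ‖g‖ ^ 2 + (t - μ) * ⟪g, p⟫ + a * ‖p‖ ^ 2 + C * ‖w‖ ^ 2
        + 12 / 5 * β / μ * (t * (t - 1)) * ‖e‖ ^ 2 - β * (2 - 3 * μ) / 8 * t * ‖g‖ ^ 2 := by
  have hτ : 0 < t - 1 := by linarith
  have ht0 : 0 < t := by linarith
  have hv : 0 < 2 - μ := by linarith
  have hn : 0 < t - μ / 2 := by linarith
  have hn2 : 0 < 2 * t - μ := by linarith
  have hA := inexact_step_correlation hμ0 hμ1 hβ hβbar (by linarith) h1 h2 hM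
  have hge : ‖g + e‖ ^ 2 = ‖g‖ ^ 2 + 2 * ⟪g, e⟫ + ‖e‖ ^ 2 := norm_add_sq_real g e
  have ha0 : 0 < a := by rw [ha]; positivity
  have hpp : a * ‖p'‖ ^ 2 = a * ((t - 1) / t) ^ 2 * ‖p‖ ^ 2 - μ * (⟪g, p⟫ + ⟪p, e⟫)
      + μ * (1 - μ / 2) * β * t / (t - μ / 2) * (‖g‖ ^ 2 + 2 * ⟪g, e⟫ + ‖e‖ ^ 2) := by
    rw [hp', norm_sq_contraction, inner_add_right, hge, real_inner_comm g p]
    have e1 : a * (2 * ((t - 1) / t) * ((1 - μ / 2) * η)) = μ := by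
      rw [ha, hη, show t - μ / 2 = (2 * t - μ) / 2 by ring, show 1 - μ / 2 = (2 - μ) / 2 by ring]
      generalize 2 * t - μ = q at hn2
      field_simp
      ring
    have e2 : a * ((1 - μ / 2) * η) ^ 2 = μ * (1 - μ / 2) * β * t / (t - μ / 2) := by
      rw [ha, hη, show t - μ / 2 = (2 * t - μ) / 2 by ring, show 1 - μ / 2 = (2 - μ) / 2 by ring]
      field_simp
      ring
    linear_combination (-(⟪g, p⟫ + ⟪p, e⟫)) * e1 + (‖g‖ ^ 2 + 2 * ⟪g, e⟫ + ‖e‖ ^ 2) * e2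
  have hww : C * ‖w'‖ ^ 2 = C * ‖w‖ ^ 2 - (⟪g, w⟫ + ⟪w, e⟫)
      + μ / 2 * η / 2 * (‖g‖ ^ 2 + 2 * ⟪g, e⟫ + ‖e‖ ^ 2) := by
    have hw1 := norm_sq_contraction (θ := 1) w (g + e) (μ / 2 * η)
    rw [one_smul, ← hw', inner_add_right, hge, real_inner_comm g w] at hw1
    have e1 : C * (μ * η) = 1 := by
      rw [hC, hη, show t - μ / 2 = (2 * t - μ) / 2 by ring]
      field_simp
      ring
    linear_combination C * hw1 + (-(⟪g, w⟫ + ⟪w, e⟫)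
      + μ / 4 * η * (‖g‖ ^ 2 + 2 * ⟪g, e⟫ + ‖e‖ ^ 2)) * e1
  have hwe : ⟪w', e⟫ = ⟪w, e⟫ - μ / 2 * η * (⟪g, e⟫ + ‖e‖ ^ 2) := by
    rw [hw', inner_sub_left, inner_smul_left, inner_add_left, real_inner_self_eq_norm_sq]
    simp
  have hCC : C - C' = (2 - μ) / (4 * β * ((t - 1) * (t + μ - 1))) := by
    have : 0 < t + μ - 1 := by linarith
    rw [hC, hC']
    field_simp
    ring
  have hCpos : 0 < C - C' := by
    have : 0 < t + μ - 1 := by linarith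
    rw [hCC]; positivity
  have y1 := young_inner_nonneg (X := β / (2 - μ) * (t * (t - 1))) (c := 1) hCpos (by
    have h3 : 0 < t + μ - 1 := by linarith
    have : 4 * (C - C') * (β / (2 - μ) * (t * (t - 1))) = t / (t + μ - 1) := by
      rw [hCC]
      field_simp
    rw [this, one_pow, one_le_div h3]
    linarith) w' e
  have hpos : 0 < a * (1 - ((t - 1) / t) ^ 2) := by
    refine mul_pos ha0 (sub_pos.2 (pow_lt_one₀ (by positivity) ?_ two_ne_zero))
    rw [div_lt_one ht0]; linarith
  have y2 := young_inner_nonneg hpos (shift_weight_bound hμ0 hμ1 hβ ht ha rfl) p e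
  set R := 2 * β * (1 - μ / 2) * t * (t - 1 - μ) / (t - μ / 2) with hR
  have y3 := young_inner_nonneg (c := R) (X := R ^ 2 / (2 * β)) (half_pos hβ)
    (le_of_eq (by field_simp; ring)) g e
  have hRe : t * (t - 1) * (2 * β - η) = R + 2 * (μ * (1 - μ / 2) * β * t / (t - μ / 2)) := by
    rw [hR, hη]
    generalize hq : t - μ / 2 = q at hn
    field_simp
    rw [← hq]
    ring
  have hS := mul_le_mul_of_nonneg_right (residual_coefficient_le hμ0 hμ1 hβ hβbar ht)
    (sq_nonneg ‖g‖)
  have hN1 := mul_le_mul_of_nonneg_right (squared_cross_coefficient_le hμ0 hμ1 hβ ht)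
    (sq_nonneg ‖e‖)
  have hN2 := mul_le_mul_of_nonneg_right (noise_square_coefficient_le hμ0 hμ1 hβ ht)
    (sq_nonneg ‖e‖)
  have hN := mul_le_mul_of_nonneg_right (total_noise_coefficient_le hμ0 hμ1)
    (show 0 ≤ β * (t * (t - 1)) * ‖e‖ ^ 2 by positivity)
  rw [← hη] at hS hN2
  rw [← hR] at hN1
  rw [inner_add_right] at hG
  have hpa := mul_le_mul_of_nonneg_right ha' (sq_nonneg ‖p'‖)
  generalize μ * (1 - μ / 2) * β * t / (t - μ / 2) = K at *
  have hNe : ((2 - μ) / (2 * μ) + 1 / 2 + (2 - μ) ^ 2 / 2 + μ * (2 - μ) / 4 + 1 / (2 - μ))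
      * (β * (t * (t - 1)) * ‖e‖ ^ 2)
      = β * (2 - μ) / (2 * μ) * (t * (t - 1)) * ‖e‖ ^ 2 + β / 2 * (t * (t - 1)) * ‖e‖ ^ 2
        + β * (2 - μ) ^ 2 / 2 * (t * (t - 1)) * ‖e‖ ^ 2
        + β * (μ * (2 - μ) / 4) * (t * (t - 1)) * ‖e‖ ^ 2
        + β / (2 - μ) * (t * (t - 1)) * ‖e‖ ^ 2 := by ring
  have hNf : 12 / (5 * μ) * (β * (t * (t - 1)) * ‖e‖ ^ 2)
      = 12 / 5 * β / μ * (t * (t - 1)) * ‖e‖ ^ 2 := by ring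
  rw [hNe, hNf] at hN
  have hcross : t * (t - 1) * (2 * β - η) * ⟪g, e⟫ = R * ⟪g, e⟫ + 2 * K * ⟪g, e⟫ := by
    rw [hRe]; ring
  rw [hcross] at hA
  rw [hwe] at y1
  linarith

lemma lyapunov_lower_bound {μ β βbar s a C : ℝ} (hμ0 : 0 < μ) (hμ1 : μ < 2 / 3) (hβ : 0 < β)
    (hβbar : β ≤ βbar) (hs : 0 ≤ s) (ha : 0 ≤ a) (hC : 1 / (2 * μ * β) ≤ C)
    {p g w : E} (hG : βbar * ‖g‖ ^ 2 ≤ ⟪g, p + w⟫) :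
    β / 2 * s ^ 2 * ‖g‖ ^ 2
      ≤ β * s * (s - 1) * ‖g‖ ^ 2 + s * ⟪g, p⟫ + a * ‖p‖ ^ 2 + C * ‖w‖ ^ 2 := by
  have hC2 : 1 / (2 * β) ≤ C := by
    refine le_trans ?_ hC
    exact one_div_le_one_div_of_le (by positivity) (by nlinarith)
  have y := young_inner_nonneg (α := 1 / (2 * β)) (c := -s) (X := β / 2 * s ^ 2) (by positivity)
    (le_of_eq (by field_simp; ring)) w g
  rw [inner_add_right, real_inner_comm w g] at hG
  have h1 := mul_le_mul_of_nonneg_left hG hs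
  have h2 := mul_le_mul_of_nonneg_right hC2 (sq_nonneg ‖w‖)
  have h3 := mul_le_mul_of_nonneg_left (mul_le_mul_of_nonneg_right hβbar (sq_nonneg ‖g‖)) hs
  have h4 : 0 ≤ a * ‖p‖ ^ 2 := by positivity
  linarith

lemma correlation_step_crude {μ β βbar t η m : ℝ} (hμ0 : 0 < μ) (hμ1 : μ < 2 / 3) (hβ : 0 < β)
    (hβbar : (2 + μ) / (2 - μ) * β ≤ βbar) (ht : 1 + 2 * μ ≤ t)
    (hη : η = 2 * β * (t - 1) / (t - μ / 2)) (hm : 0 ≤ m)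
    {d p p' g g' e : E}
    (h1 : (t - 1) • d = -p' - (2 * β * (t - 1)) • (g + e))
    (h2 : t • d = -p - (t * η) • (g + e))
    (hM : βbar * ‖g' - g‖ ^ 2 + m ≤ ⟪g' - g, d⟫) :
    β * t * (t - 1) * ‖g'‖ ^ 2 + t * ⟪g', p'⟫
      ≤ β * (t - μ) * (t - μ - 1) * ‖g‖ ^ 2 + (t - μ) * ⟪g, p⟫
        + (1 + 2 * μ * β + β) * (t * ‖g‖ ^ 2) + ‖p‖ ^ 2 / t
        + 2 * β / μ * (t * (t - 1) * ‖e‖ ^ 2) := by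
  have hτ : 0 < t - 1 := by linarith
  have ht0 : 0 < t := by linarith
  have hA := inexact_step_correlation hμ0 hμ1 hβ hβbar (by linarith) h1 h2 hM
  have hg := step_size_gap hμ0 hμ1 hβ ht
  have hb := (step_size_bounds hμ0 hμ1 hβ ht).2
  rw [← hη] at hg hb
  have hm' : 0 ≤ t * (t - 1) * m := by positivity
  have y1 := young_inner_nonneg (α := 1 / t) (c := 1 - μ) (X := t) (by positivity)
    (by rw [mul_one_div, div_mul_cancel₀ _ ht0.ne']; nlinarith) p g
  rw [real_inner_comm g p] at y1
  have c1 : t * (t - 1) * (η - β) * ‖g‖ ^ 2 ≤ t * (t - 1) * β * ‖g‖ ^ 2 := by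
    refine mul_le_mul_of_nonneg_right (mul_le_mul_of_nonneg_left ?_ (by positivity)) (by positivity)
    linarith
  have c2 : t * (t - 1) * β * ‖g‖ ^ 2
      ≤ β * (t - μ) * (t - μ - 1) * ‖g‖ ^ 2 + 2 * μ * β * (t * ‖g‖ ^ 2) := by
    have : 0 ≤ β * (μ ^ 2 + μ) * ‖g‖ ^ 2 := by positivity
    linarith
  have c3 : -(t * (t - 1) * (2 * β - η) * ⟪g, e⟫) ≤ β * t * (‖g‖ ^ 2 + ‖e‖ ^ 2) := by
    have q : |⟪g, e⟫| ≤ (‖g‖ ^ 2 + ‖e‖ ^ 2) / 2 := by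
      refine (abs_real_inner_le_norm g e).trans ?_
      nlinarith [sq_nonneg (‖g‖ - ‖e‖)]
    have q2 := neg_abs_le ⟪g, e⟫
    calc -(t * (t - 1) * (2 * β - η) * ⟪g, e⟫)
        = t * (t - 1) * (2 * β - η) * (-⟪g, e⟫) := by ring
      _ ≤ t * (t - 1) * (2 * β - η) * ((‖g‖ ^ 2 + ‖e‖ ^ 2) / 2) :=
        mul_le_mul_of_nonneg_left (by linarith) hg.1
      _ ≤ 2 * β * t * ((‖g‖ ^ 2 + ‖e‖ ^ 2) / 2) :=
        mul_le_mul_of_nonneg_right hg.2 (by positivity)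
      _ = _ := by ring
  have c4 : β * t * ‖e‖ ^ 2 + β * (2 - μ) / (2 * μ) * (t * (t - 1)) * ‖e‖ ^ 2
      ≤ 2 * β / μ * (t * (t - 1) * ‖e‖ ^ 2) := by
    have q : 2 * β / μ * (t * (t - 1) * ‖e‖ ^ 2)
        - (β * t * ‖e‖ ^ 2 + β * (2 - μ) / (2 * μ) * (t * (t - 1)) * ‖e‖ ^ 2)
        = β * t * ‖e‖ ^ 2 * ((2 + μ) * (t - 1) - 2 * μ) / (2 * μ) := by
      field_simp
      ring
    have : 0 ≤ (2 + μ) * (t - 1) - 2 * μ := by nlinarith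
    rw [← sub_nonneg, q]
    positivity
  have c5 : 1 / t * ‖p‖ ^ 2 = ‖p‖ ^ 2 / t := by ring
  linarith

end Step

section Sequences

lemma summable_of_descent {Φ a s : ℕ → ℝ} (hΦ : ∀ k, 0 ≤ Φ k) (ha : ∀ k, 0 ≤ a k)
    (hs0 : ∀ k, 0 ≤ s k) (hs : Summable s) (h : ∀ k, Φ (k + 1) + a k ≤ Φ k + s k) :
    Summable a := by
  have hind : ∀ n, Φ n + ∑ i ∈ Finset.range n, a i ≤ Φ 0 + ∑ i ∈ Finset.range n, s i := by
    intro n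
    induction n with
    | zero => simp
    | succ n ih =>
      rw [Finset.sum_range_succ, Finset.sum_range_succ]
      linarith [h n]
  refine summable_of_sum_range_le (c := Φ 0 + ∑' i, s i) ha fun n => ?_
  have h1 := hs.sum_le_tsum (Finset.range n) fun i _ => hs0 i
  linarith [hind n, hΦ n]

lemma eventually_le_of_quasi_descent {U s : ℕ → ℝ} (hs0 : ∀ k, 0 ≤ s k) (hs : Summable s)
    (h : ∀ k, U (k + 1) ≤ U k + s k) (hU : Summable fun k : ℕ => |U k| / ((k : ℝ) + 1))
    {ε : ℝ} (hε : 0 < ε) : ∀ᶠ k in atTop, U k ≤ ε := by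
  have htail := tendsto_sum_nat_add s
  obtain ⟨N, hN⟩ := ((htail.eventually (gt_mem_nhds (half_pos hε)))).exists
  have hex : ∃ j, N ≤ j ∧ |U j| < ε / 2 := by
    by_contra! hcon
    have hdiv : Summable fun k : ℕ => (ε / 2) * (1 / (((k + N : ℕ) : ℝ) + 1)) := by
      refine Summable.of_nonneg_of_le (fun k => by positivity) (fun k => ?_)
        ((summable_nat_add_iff N).2 hU)
      rw [mul_one_div]
      exact div_le_div_of_nonneg_right (hcon (k + N) (Nat.le_add_left _ _)) (by positivity)
    rw [summable_mul_left_iff (half_pos hε).ne'] at hdiv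
    have h2 := (summable_nat_add_iff (f := fun k : ℕ => 1 / ((k : ℝ) + 1)) N).1 hdiv
    have h3 : Summable fun k : ℕ => 1 / ((k + 1 : ℕ) : ℝ) := by simpa using h2
    exact Real.not_summable_one_div_natCast ((summable_nat_add_iff 1).1 h3)
  obtain ⟨j, hNj, hj⟩ := hex
  filter_upwards [eventually_ge_atTop j] with k hk
  obtain ⟨n, rfl⟩ := Nat.exists_eq_add_of_le hk
  have hind : ∀ n, U (j + n) ≤ U j + ∑ i ∈ Finset.range n, s (i + j) := by
    intro n
    induction n with
    | zero => simp
    | succ n ih =>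
      rw [Finset.sum_range_succ, ← add_assoc]
      have := h (j + n)
      rw [add_comm n j]
      linarith
  have h1 : ∑ i ∈ Finset.range n, s (i + j) ≤ ∑' i, s (i + N) := by
    obtain ⟨m, rfl⟩ := Nat.exists_eq_add_of_le hNj
    have hsN := (summable_nat_add_iff N).2 hs
    have e : ∀ i, s (i + (N + m)) = (fun i => s (i + N)) (i + m) := fun i => by
      simp only [add_assoc, add_comm N m]
    calc ∑ i ∈ Finset.range n, s (i + (N + m))
        = ∑ i ∈ Finset.range n, (fun i => s (i + N)) (i + m) := Finset.sum_congr rfl fun i _ => e i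
      _ ≤ ∑' i, (fun i => s (i + N)) (i + m) :=
        ((summable_nat_add_iff m).2 hsN).sum_le_tsum _ fun i _ => hs0 _
      _ ≤ ∑' i, s (i + N) := by
        rw [← hsN.sum_add_tsum_nat_add m]
        exact le_add_of_nonneg_left (Finset.sum_nonneg fun i _ => hs0 _)
  linarith [hind n, le_abs_self (U j)]

lemma tendsto_zero_of_quasi_descent {U s : ℕ → ℝ} (hU0 : ∀ k, 0 ≤ U k) (hs0 : ∀ k, 0 ≤ s k)
    (hs : Summable s) (h : ∀ k, U (k + 1) ≤ U k + s k)
    (hU : Summable fun k : ℕ => U k / ((k : ℝ) + 1)) : Tendsto U atTop (nhds 0) := by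
  have hU' : Summable fun k : ℕ => |U k| / ((k : ℝ) + 1) := by
    simpa only [abs_of_nonneg (hU0 _)] using hU
  refine tendsto_order.2 ⟨fun a ha => Eventually.of_forall fun k => ha.trans_le (hU0 k),
    fun a ha => ?_⟩
  filter_upwards [eventually_le_of_quasi_descent hs0 hs h hU' (half_pos ha)] with k hk
  linarith

lemma shift_weight_antitone {μ β t : ℝ} (hμ0 : 0 < μ) (hμ1 : μ < 2 / 3) (hβ : 0 < β)
    (ht : 1 + 2 * μ ≤ t) :
    μ * (t + μ) * (2 * (t + μ) - μ) / (4 * β * (2 - μ) * (t + μ - 1) ^ 2)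
      ≤ μ * t * (2 * t - μ) / (4 * β * (2 - μ) * (t - 1) ^ 2) := by
  have h1 : 0 < t - 1 := by linarith
  have h2 : 0 < t + μ - 1 := by linarith
  have h3 : 0 < 2 - μ := by linarith
  have h4 : 0 < 2 * t - μ := by linarith
  have h5 : 0 < 2 * (t + μ) - μ := by linarith
  have h0 : 0 < t := by linarith
  have e : ∀ x : ℝ, μ * x * (2 * x - μ) / (4 * β * (2 - μ) * (x - 1) ^ 2)
      = μ / (4 * β * (2 - μ)) * (x / (x - 1) * ((2 * x - μ) / (x - 1))) := by
    intro x
    rw [div_mul_div_comm, div_mul_div_comm]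
    ring
  rw [e, e]
  refine mul_le_mul_of_nonneg_left (mul_le_mul ?_ ?_ (by positivity) (by positivity))
    (by positivity)
  · rw [div_le_div_iff₀ h2 h1]; nlinarith
  · rw [div_le_div_iff₀ h2 h1]; nlinarith

lemma rates_of_lyapunov_descent {μ r β Λ : ℝ} (hμ0 : 0 < μ) (hμ1 : μ < 2 / 3)
    (hr : 2 + 1 / μ ≤ r) (hβ : 0 < β) (hΛ : 0 ≤ Λ)
    {t A a C : ℕ → ℝ} (ht : ∀ k, t k = μ * ((k : ℝ) + r))
    (hA : ∀ k, A k = (t k - μ) * (t k - μ - 1))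
    {γ D P q W ε ee X κ Θ σ Γ : ℕ → ℝ}
    (hγ : ∀ k, 0 ≤ γ k) (hee : ∀ k, 0 ≤ ee k) (hP : ∀ k, 0 ≤ P k)
    (hX0 : ∀ k, 0 ≤ X k) (hP0 : P 0 = 0) (hq0 : q 0 = 0)
    (hΓ : ∀ k, 0 < Γ k) (hΘ : ∀ k, 0 < Θ k) (hε : ∀ k, 0 ≤ ε k)
    (hΓΘ : ∀ k, Γ k * Θ k ≤ 2 * Λ)
    (heD : ∀ k, ee k ≤ D k) (hD0 : D 0 ≤ σ 0 ^ 2)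
    (hD : ∀ k, D (k + 1) ≤ (1 - κ (k + 1)) * D k + Θ (k + 1) * ε (k + 1) + σ (k + 1) ^ 2)
    (hκ : ∀ k, (1 - κ (k + 1)) * (Γ (k + 1) * A (k + 1)) ≤ Γ k * A k - 5 * β / μ * A (k + 1))
    (hB : Summable fun k => A k * σ k ^ 2 / Θ k)
    (hV : ∀ k, β * t k * (t k - 1) * γ (k + 1) + t k * q (k + 1) + a (k + 1) * P (k + 1)
        + C (k + 1) * W (k + 1) + t k * (t k - 1) * (Λ * ε (k + 1))
      ≤ β * (t k - μ) * (t k - μ - 1) * γ k + (t k - μ) * q k + a k * P k + C k * W k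
        + 12 / 5 * β / μ * (t k * (t k - 1)) * ee k - β * (2 - 3 * μ) / 8 * t k * γ k)
    (hlow : ∀ k, β / 2 * (t k - μ) ^ 2 * γ k
      ≤ β * (t k - μ) * (t k - μ - 1) * γ k + (t k - μ) * q k + a k * P k + C k * W k)
    (hU : ∀ k, β * t k * (t k - 1) * γ (k + 1) + t k * q (k + 1)
      ≤ β * (t k - μ) * (t k - μ - 1) * γ k + (t k - μ) * q k
        + (1 + 2 * μ * β + β) * (t k * γ k) + P k / t k
        + 2 * β / μ * (t k * (t k - 1) * ee k))
    (hPs : ∀ k, P (k + 1) + P k / t k ≤ P k + 8 * β ^ 2 * t k * (γ k + ee k))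
    (hX : ∀ k, X k ≤ 2 * P k / t k ^ 2 + 16 * β ^ 2 * (γ k + ee k))
    (hq : ∀ k (c : ℝ), 0 < c → |q k| ≤ c * γ k + P k / c) :
    (∀ k, β / 2 * (t k - μ) ^ 2 * γ k
        ≤ β * A 0 * γ 0 + C 0 * W 0 + Λ * ∑' k, A k * σ k ^ 2 / Θ k)
    ∧ Summable (fun k : ℕ => ((k : ℝ) + 1) * γ k)
    ∧ Summable (fun k : ℕ => ((k : ℝ) + 1) ^ 2 * ee k)
    ∧ Summable (fun k : ℕ => ((k : ℝ) + 1) * X k)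
    ∧ Tendsto (fun k : ℕ => (k : ℝ) ^ 2 * X k) atTop (nhds 0)
    ∧ Tendsto (fun k : ℕ => (k : ℝ) ^ 2 * γ k) atTop (nhds 0) := by
  have hμr : 1 + 2 * μ ≤ μ * r := by
    have := mul_le_mul_of_nonneg_left hr hμ0.le
    rw [mul_add, mul_one_div_cancel hμ0.ne'] at this
    linarith
  have hr1 : 1 ≤ r := by
    have : 0 < 1 / μ := by positivity
    linarith
  have hr0 : 0 < r := by linarith
  have hμk : ∀ k : ℕ, 0 ≤ μ * (k : ℝ) := fun k => by positivity
  have ht1 : ∀ k, 1 + 2 * μ ≤ t k := fun k => by rw [ht]; linarith [hμk k]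
  have htpos : ∀ k, 0 < t k := fun k => by linarith [ht1 k]
  have htk : ∀ k : ℕ, μ * ((k : ℝ) + 1) ≤ t k - 1 := fun k => by rw [ht]; linarith
  have htk' : ∀ k : ℕ, t k ≤ μ * r * ((k : ℝ) + 1) := fun k => by
    rw [ht]; nlinarith [mul_nonneg (hμk k) (sub_nonneg.2 hr1)]
  have hAs : ∀ k, A (k + 1) = t k * (t k - 1) := fun k => by
    have : t (k + 1) - μ = t k := by rw [ht, ht]; push_cast; ring
    rw [hA, this]
  have hApos : ∀ k, 0 < A k := fun k => by
    rw [hA]; exact mul_pos (by linarith [ht1 k]) (by linarith [ht1 k])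
  have hDn : ∀ k, 0 ≤ D k := fun k => (hee k).trans (heD k)
  have hm : 0 < 2 - 3 * μ := by linarith
  set b : ℕ → ℝ := fun k => A k * σ k ^ 2 / Θ k with hb
  have hb0 : ∀ k, 0 ≤ b k := fun k =>
    div_nonneg (mul_nonneg (hApos k).le (sq_nonneg _)) (hΘ k).le
  have hσb : ∀ k, Γ k * A k * σ k ^ 2 / 2 ≤ Λ * b k := by
    intro k
    have h1 : Γ k * A k * σ k ^ 2 / 2 = Γ k * Θ k * (b k / 2) := by
      have := (hΘ k).ne'
      simp only [hb]
      field_simp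
    have h2 := mul_le_mul_of_nonneg_right (hΓΘ k) (div_nonneg (hb0 k) zero_le_two)
    rw [h1]
    linarith
  set Φ : ℕ → ℝ := fun k => β * (t k - μ) * (t k - μ - 1) * γ k + (t k - μ) * q k + a k * P k
    + C k * W k + Γ k * A k * D k / 2 with hΦ
  have hlowΦ : ∀ k, β / 2 * (t k - μ) ^ 2 * γ k ≤ Φ k := fun k => by
    have : 0 ≤ Γ k * A k * D k / 2 :=
      div_nonneg (mul_nonneg (mul_nonneg (hΓ k).le (hApos k).le) (hDn k)) zero_le_two
    simp only [hΦ]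
    linarith [hlow k]
  have hΦ0 : ∀ k, 0 ≤ Φ k := fun k =>
    (mul_nonneg (mul_nonneg (half_pos hβ).le (sq_nonneg _)) (hγ k)).trans (hlowΦ k)
  have hstep : ∀ k, Φ (k + 1) + (β / (10 * μ) * (A (k + 1) * D k)
      + β * (2 - 3 * μ) / 8 * (t k * γ k)) ≤ Φ k + Λ * b (k + 1) := by
    intro k
    have h1 := hV k
    have hΓA : 0 ≤ Γ (k + 1) * A (k + 1) := (mul_pos (hΓ _) (hApos _)).le
    have h2 := mul_le_mul_of_nonneg_left (hD k) hΓA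
    have h3 := mul_le_mul_of_nonneg_right (hκ k) (hDn k)
    have h4 := mul_le_mul_of_nonneg_right (hΓΘ (k + 1))
      (mul_nonneg (hApos (k + 1)).le (hε (k + 1)))
    have h5 := hσb (k + 1)
    have h6 : 12 / 5 * β / μ * A (k + 1) * ee k ≤ 12 / 5 * β / μ * A (k + 1) * D k :=
      mul_le_mul_of_nonneg_left (heD k)
        (mul_nonneg (by positivity) (hApos _).le)
    have e1 : t (k + 1) - μ = t k := by rw [ht, ht]; push_cast; ring
    have e2 : 5 * β / μ * A (k + 1) * D k = 2 * (12 / 5 * β / μ * A (k + 1) * D k)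
        + 2 * (β / (10 * μ) * (A (k + 1) * D k)) := by
      field_simp
      ring
    rw [← hAs] at h1
    simp only [hΦ, e1]
    linarith
  have hbs : Summable fun k => Λ * b (k + 1) := ((summable_nat_add_iff 1).2 hB).mul_left Λ
  have hdrop : Summable fun k => β / (10 * μ) * (A (k + 1) * D k)
      + β * (2 - 3 * μ) / 8 * (t k * γ k) := by
    refine summable_of_descent hΦ0 (fun k => ?_) (fun k => mul_nonneg hΛ (hb0 _)) hbs hstep
    have := hApos (k + 1); have := hDn k; have := htpos k; have := hγ k
    positivity
  have hAD : Summable fun k => A (k + 1) * D k := by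
    have : Summable fun k => β / (10 * μ) * (A (k + 1) * D k) := by
      refine hdrop.of_nonneg_of_le (fun k => ?_) (fun k => ?_)
      · have := hApos (k + 1); have := hDn k
        positivity
      · have := htpos k; have := hγ k
        exact le_add_of_nonneg_right (by positivity)
    exact (summable_mul_left_iff (by positivity)).1 this
  have htγ : Summable fun k => t k * γ k := by
    have : Summable fun k => β * (2 - 3 * μ) / 8 * (t k * γ k) := by
      refine hdrop.of_nonneg_of_le (fun k => ?_) (fun k => ?_)
      · have := htpos k; have := hγ k
        positivity
      · have := hApos (k + 1); have := hDn k
        exact le_add_of_nonneg_left (by positivity)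
    exact (summable_mul_left_iff (by positivity)).1 this
  have hAe : Summable fun k => t k * (t k - 1) * ee k := by
    refine hAD.of_nonneg_of_le (fun k => ?_) (fun k => ?_)
    · rw [← hAs]; exact mul_nonneg (hApos _).le (hee k)
    · rw [← hAs]; exact mul_le_mul_of_nonneg_left (heD k) (hApos _).le
  have hte : Summable fun k => t k * ee k := by
    refine (hAe.mul_left (1 / (2 * μ))).of_nonneg_of_le
      (fun k => mul_nonneg (htpos k).le (hee k)) (fun k => ?_)
    have : t k * ee k * (2 * μ) ≤ t k * ee k * (t k - 1) :=
      mul_le_mul_of_nonneg_left (by linarith [ht1 k]) (mul_nonneg (htpos k).le (hee k))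
    rw [one_div, ← div_eq_inv_mul, le_div_iff₀ (by positivity)]
    linarith
  have hge : Summable fun k => 8 * β ^ 2 * t k * (γ k + ee k) := by
    refine ((htγ.add hte).mul_left (8 * β ^ 2)).congr fun k => ?_
    ring
  have hge0 : ∀ k, 0 ≤ 8 * β ^ 2 * t k * (γ k + ee k) := fun k => by
    have := htpos k; have := hγ k; have := hee k
    positivity
  have hPt : Summable fun k => P k / t k :=
    summable_of_descent hP (fun k => div_nonneg (hP k) (htpos k).le) hge0 hge hPs
  have hdiv : ∀ (k : ℕ) (x : ℝ), 0 ≤ x → x / ((k : ℝ) + 1) ≤ μ * r * (x / t k) := by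
    intro k x hx
    rw [← mul_div_assoc, div_le_div_iff₀ (by positivity) (htpos k)]
    nlinarith [mul_le_mul_of_nonneg_left (htk' k) hx]
  have hPlim : Tendsto P atTop (nhds 0) := by
    refine tendsto_zero_of_quasi_descent hP hge0 hge (fun k => ?_) ?_
    · linarith [hPs k, div_nonneg (hP k) (htpos k).le]
    · exact (hPt.mul_left (μ * r)).of_nonneg_of_le (fun k => div_nonneg (hP k) (by positivity))
        fun k => hdiv k _ (hP k)
  set U : ℕ → ℝ := fun k => β * (t k - μ) * (t k - μ - 1) * γ k + (t k - μ) * q k with hUdef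
  set s : ℕ → ℝ := fun k => (1 + 2 * μ * β + β) * (t k * γ k) + P k / t k
        + 2 * β / μ * (t k * (t k - 1) * ee k) with hsdef
  have hs : Summable s := ((htγ.mul_left _).add hPt).add (hAe.mul_left _)
  have hs0 : ∀ k, 0 ≤ s k := fun k => by
    have := htpos k; have := hγ k; have := hee k; have := hP k
    have : 0 ≤ t k - 1 := by linarith [ht1 k]
    simp only [hsdef]
    positivity
  have hUs : ∀ k, U (k + 1) ≤ U k + s k := fun k => by
    have e1 : t (k + 1) - μ = t k := by rw [ht, ht]; push_cast; ring
    simp only [hUdef, hsdef, e1]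
    linarith [hU k]
  have hUabs : ∀ k, |U k| ≤ (β + 1) * (t k * (t k * γ k)) + P k := by
    intro k
    have h1 := hq k (t k) (htpos k)
    have g0 := hγ k
    have t1 := ht1 k
    have h2 : |β * (t k - μ) * (t k - μ - 1) * γ k| ≤ β * (t k * (t k * γ k)) := by
      rw [abs_of_nonneg (mul_nonneg (mul_nonneg (mul_nonneg hβ.le (by linarith)) (by linarith)) g0)]
      have : (t k - μ) * (t k - μ - 1) ≤ t k * t k :=
        mul_le_mul (by linarith) (by linarith) (by linarith) (htpos k).le
      calc β * (t k - μ) * (t k - μ - 1) * γ k = β * γ k * ((t k - μ) * (t k - μ - 1)) := by ring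
        _ ≤ β * γ k * (t k * t k) := mul_le_mul_of_nonneg_left this (by positivity)
        _ = _ := by ring
    have h3 : |(t k - μ) * q k| ≤ t k * (t k * γ k) + P k := by
      rw [abs_mul, abs_of_nonneg (by linarith : 0 ≤ t k - μ)]
      calc (t k - μ) * |q k| ≤ t k * (t k * γ k + P k / t k) :=
            mul_le_mul (by linarith) h1 (abs_nonneg _) (htpos k).le
        _ = _ := by rw [mul_add, mul_div_cancel₀ _ (htpos k).ne']
    calc |U k| ≤ _ := abs_add_le _ _
      _ ≤ _ := by linarith
  have hUsum : Summable fun k : ℕ => |U k| / ((k : ℝ) + 1) := by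
    refine (((htγ.mul_left (β + 1)).add hPt).mul_left (μ * r)).of_nonneg_of_le
      (fun k => by positivity) (fun k => ?_)
    refine (hdiv k _ (abs_nonneg _)).trans (mul_le_mul_of_nonneg_left ?_ (by positivity))
    rw [div_le_iff₀ (htpos k), add_mul, div_mul_cancel₀ _ (htpos k).ne']
    linarith [hUabs k]
  have hUlow : ∀ k : ℕ, (k : ℝ) ^ 2 * γ k
      ≤ 2 / (β * μ ^ 2) * (U k + 2 * (1 + 1 / μ) / β * P k) := by
    intro k
    have t1 := ht1 k
    set x := t k - μ - 1 with hx
    have hxk : μ * k ≤ x := by linarith [htk k]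
    have hxμ : μ ≤ x := by linarith
    have hx0 : 0 < x := by linarith
    have h1 := hq k (β * x / 2) (by positivity)
    have h2 : (x + 1) * |q k| ≤ β / 2 * ((x + 1) * x) * γ k + 2 * (1 + 1 / μ) / β * P k := by
      have h3 : (x + 1) * (P k / (β * x / 2)) = 2 * (1 + 1 / x) / β * P k := by
        field_simp
      have h4 : 1 / x ≤ 1 / μ := one_div_le_one_div_of_le hμ0 hxμ
      have h5 : 2 * (1 + 1 / x) / β * P k ≤ 2 * (1 + 1 / μ) / β * P k := by
        have := hP k
        gcongr
      have h6 := mul_le_mul_of_nonneg_left h1 (by linarith : 0 ≤ x + 1)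
      linarith
    have h7 : U k = β * ((x + 1) * x) * γ k + (x + 1) * q k := by
      simp only [hUdef, hx]; ring
    have h8 : -((x + 1) * |q k|) ≤ (x + 1) * q k := by
      have := mul_le_mul_of_nonneg_left (neg_abs_le (q k)) (by linarith : 0 ≤ x + 1)
      linarith
    have h9 : β / 2 * (μ * k) ^ 2 * γ k ≤ U k + 2 * (1 + 1 / μ) / β * P k := by
      have : (μ * k) ^ 2 ≤ (x + 1) * x := by nlinarith [hμk k]
      have := mul_le_mul_of_nonneg_left this (mul_nonneg (half_pos hβ).le (hγ k))
      linarith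
    calc (k : ℝ) ^ 2 * γ k = 2 / (β * μ ^ 2) * (β / 2 * (μ * k) ^ 2 * γ k) := by field_simp
      _ ≤ _ := mul_le_mul_of_nonneg_left h9 (by positivity)
  have hγlim : Tendsto (fun k : ℕ => (k : ℝ) ^ 2 * γ k) atTop (nhds 0) := by
    refine tendsto_order.2 ⟨fun y hy => Eventually.of_forall fun k => hy.trans_le ?_,
      fun y hy => ?_⟩
    · exact mul_nonneg (sq_nonneg _) (hγ k)
    · have hc : 0 < 2 / (β * μ ^ 2) := by positivity
      have hc2 : Tendsto (fun k => 2 * (1 + 1 / μ) / β * P k) atTop (nhds 0) := by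
        simpa using hPlim.const_mul (2 * (1 + 1 / μ) / β)
      have hδ : 0 < y / (2 / (β * μ ^ 2)) / 2 := by positivity
      filter_upwards [eventually_le_of_quasi_descent hs0 hs hUs hUsum hδ,
        hc2.eventually (gt_mem_nhds hδ)] with k h1 h2
      refine (hUlow k).trans_lt ?_
      rw [mul_comm, ← lt_div_iff₀ hc]
      linarith
  have hXk : ∀ k : ℕ, (k : ℝ) ^ 2 * X k
      ≤ 2 / μ ^ 2 * P k + 16 * β ^ 2 * ((k : ℝ) ^ 2 * γ k)
        + 16 * β ^ 2 / μ ^ 2 * (t k * (t k - 1) * ee k) := by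
    intro k
    have t1 := ht1 k
    have hk0 := hμk k
    have h1 : (μ * k) ^ 2 ≤ t k ^ 2 := by
      have := htk k
      gcongr
      linarith
    have h2 : (μ * k) ^ 2 ≤ t k * (t k - 1) := by nlinarith [htk k]
    have h3 : (k : ℝ) ^ 2 * (2 * P k / t k ^ 2) ≤ 2 / μ ^ 2 * P k := by
      have := htpos k
      have e : (k : ℝ) ^ 2 * (2 * P k / t k ^ 2) = 2 / μ ^ 2 * P k * ((μ * k) ^ 2 / t k ^ 2) := by
        field_simp
      rw [e]
      exact mul_le_of_le_one_right (mul_nonneg (by positivity) (hP k))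
        ((div_le_one (by positivity)).2 h1)
    have h4 : (k : ℝ) ^ 2 * ee k ≤ 1 / μ ^ 2 * (t k * (t k - 1) * ee k) := by
      rw [one_div, ← div_eq_inv_mul, le_div_iff₀ (by positivity)]
      linarith [mul_le_mul_of_nonneg_right h2 (hee k)]
    have h5 := mul_le_mul_of_nonneg_left (hX k) (sq_nonneg (k : ℝ))
    have h6 := mul_le_mul_of_nonneg_left h4 (by positivity : 0 ≤ 16 * β ^ 2)
    have h7 : 16 * β ^ 2 * (1 / μ ^ 2 * (t k * (t k - 1) * ee k))
      = 16 * β ^ 2 / μ ^ 2 * (t k * (t k - 1) * ee k) := by ring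
    linarith
  refine ⟨fun k => ?_, ?_, ?_, ?_, ?_, hγlim⟩
  · have hind : ∀ n, Φ n ≤ β * A 0 * γ 0 + C 0 * W 0
        + ∑ i ∈ Finset.range (n + 1), Λ * b i := by
      intro n
      induction n with
      | zero =>
        have h1 := hσb 0
        have h2 := mul_le_mul_of_nonneg_left hD0 (mul_pos (hΓ 0) (hApos 0)).le
        simp only [hΦ, hP0, hq0, zero_add, Finset.sum_range_one, hA 0] at *
        linarith
      | succ n ih =>
        rw [Finset.sum_range_succ]
        have h1 : 0 ≤ β / (10 * μ) * (A (n + 1) * D n) + β * (2 - 3 * μ) / 8 * (t n * γ n) := by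
          have := hApos (n + 1); have := hDn n; have := htpos n; have := hγ n
          positivity
        linarith [hstep n]
    have h1 := (hB.mul_left Λ).sum_le_tsum (Finset.range (k + 1))
      fun i _ => mul_nonneg hΛ (hb0 i)
    rw [tsum_mul_left] at h1
    exact (hlowΦ k).trans ((hind k).trans (add_le_add_right h1 _))
  · refine (htγ.mul_left (1 / μ)).of_nonneg_of_le (fun k => mul_nonneg (by positivity) (hγ k))
      fun k => ?_
    rw [one_div, ← div_eq_inv_mul, le_div_iff₀ hμ0]
    linarith [mul_le_mul_of_nonneg_right (htk k) (hγ k), hγ k]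
  · refine (hAe.mul_left (1 / μ ^ 2)).of_nonneg_of_le
      (fun k => mul_nonneg (by positivity) (hee k)) fun k => ?_
    rw [one_div, ← div_eq_inv_mul, le_div_iff₀ (by positivity)]
    have h0 : 0 ≤ μ * ((k : ℝ) + 1) := by positivity
    have : (μ * ((k : ℝ) + 1)) ^ 2 ≤ t k * (t k - 1) := by nlinarith [htk k]
    linarith [mul_le_mul_of_nonneg_right this (hee k)]
  · refine ((hPt.mul_left (2 / μ)).add ((htγ.add hte).mul_left (16 * β ^ 2 / μ))).of_nonneg_of_le
      (fun k => mul_nonneg (by positivity) (hX0 k)) fun k => ?_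
    have t0 := htpos k
    have hk : (k : ℝ) + 1 ≤ t k / μ := by
      rw [le_div_iff₀ hμ0]; linarith [htk k]
    calc ((k : ℝ) + 1) * X k ≤ t k / μ * (2 * P k / t k ^ 2 + 16 * β ^ 2 * (γ k + ee k)) :=
          mul_le_mul hk (hX k) (hX0 k) (by positivity)
      _ = _ := by field_simp
  · have hlim : Tendsto (fun k : ℕ => 2 / μ ^ 2 * P k + 16 * β ^ 2 * ((k : ℝ) ^ 2 * γ k)
        + 16 * β ^ 2 / μ ^ 2 * (t k * (t k - 1) * ee k)) atTop (nhds 0) := by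
      simpa using ((hPlim.const_mul (2 / μ ^ 2)).add (hγlim.const_mul (16 * β ^ 2))).add
        (hAe.tendsto_atTop_zero.const_mul (16 * β ^ 2 / μ ^ 2))
    exact squeeze_zero (fun k => mul_nonneg (sq_nonneg _) (hX0 k)) hXk hlim

end Sequences

section Iteration

variable {E : Type*} [NormedAddCommGroup E] [InnerProductSpace ℝ E]

lemma anchored_step_identities {μ β t η : ℝ} (ht0 : t ≠ 0) (htμ : t - μ / 2 ≠ 0)
    (hη : η = 2 * β * (t - 1) / (t - μ / 2)) {x x' y z z' v : E}
    (hy : y = (1 / t) • ((t - 1) • x + z)) (hx' : x' = y - η • v)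
    (hz' : z' = z + (μ / 2) • (x' - y)) :
    (t - 1) • (x' - x) = -(x' - z') - (2 * β * (t - 1)) • v
      ∧ t • (x' - x) = -(x - z) - (t * η) • v
      ∧ x' - z' = ((t - 1) / t) • (x - z) - ((1 - μ / 2) * η) • v
      ∧ ∀ u, z' - u = (z - u) - (μ / 2 * η) • v := by
  have hη' : 2 * β * (t - 1) = η * (t - μ / 2) := by rw [hη, div_mul_cancel₀ _ htμ]
  have e : (t - 1) / t = 1 - 1 / t := by field_simp
  have hyx : y = x - (1 / t) • (x - z) := by
    rw [hy]
    match_scalars <;> field_simp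
  rw [hη', e]
  subst hx'
  rw [hz', hyx]
  refine ⟨?_, ?_, ?_, fun u => ?_⟩
  · match_scalars <;> field_simp <;> ring
  · match_scalars <;> field_simp <;> ring
  · match_scalars <;> ring
  · match_scalars <;> ring

lemma norm_add_sq_le_two_mul (u v : E) : ‖u + v‖ ^ 2 ≤ 2 * (‖u‖ ^ 2 + ‖v‖ ^ 2) := by
  have h := parallelogram_law_with_norm ℝ u v
  nlinarith [sq_nonneg ‖u - v‖]

lemma anchor_gap_descent {β t c : ℝ} (ht : 1 ≤ t) (hc0 : 0 ≤ c) (hc : c ≤ 2 * β)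
    {p p' g e : E} (hp' : p' = ((t - 1) / t) • p - c • (g + e)) :
    ‖p'‖ ^ 2 + ‖p‖ ^ 2 / t ≤ ‖p‖ ^ 2 + 8 * β ^ 2 * t * (‖g‖ ^ 2 + ‖e‖ ^ 2) := by
  have ht0 : 0 < t := by linarith
  have h1 := norm_sq_contraction (θ := (t - 1) / t) p (g + e) c
  have h2 : 0 ≤ ((t - 1) / t) / t * ‖p + (t * c) • (g + e)‖ ^ 2 := by
    have : 0 ≤ t - 1 := by linarith
    positivity
  rw [norm_add_sq_real, inner_smul_right, norm_smul, mul_pow, Real.norm_eq_abs, sq_abs] at h2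
  have h3 : c ^ 2 * ‖g + e‖ ^ 2 ≤ (2 * β) ^ 2 * (2 * (‖g‖ ^ 2 + ‖e‖ ^ 2)) := by
    have := norm_add_sq_le_two_mul g e
    gcongr
  have h4 := mul_le_mul_of_nonneg_left h3 ht0.le
  rw [← hp'] at h1
  have h5 : ‖p'‖ ^ 2 + ((t - 1) / t) / t * (‖p‖ ^ 2 + 2 * (t * c * ⟪p, g + e⟫)
      + (t * c) ^ 2 * ‖g + e‖ ^ 2) = ‖p‖ ^ 2 - ‖p‖ ^ 2 / t + t * (c ^ 2 * ‖g + e‖ ^ 2) := by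
    rw [h1]
    field_simp
    ring
  linarith

lemma increment_norm_sq_le {β t η : ℝ} (ht : 0 < t) (hη0 : 0 ≤ η) (hη : η ≤ 2 * β)
    {d p g e : E} (h : t • d = -p - (t * η) • (g + e)) :
    ‖d‖ ^ 2 ≤ 2 * ‖p‖ ^ 2 / t ^ 2 + 16 * β ^ 2 * (‖g‖ ^ 2 + ‖e‖ ^ 2) := by
  have hd : d = (-(1 / t)) • p + (-η) • (g + e) := by
    have : d = (1 / t) • (t • d) := by rw [smul_smul, one_div_mul_cancel ht.ne', one_smul]
    rw [this, h]
    match_scalars <;> field_simp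
  have h1 := norm_add_sq_le_two_mul ((-(1 / t)) • p) ((-η) • (g + e))
  rw [← hd, norm_smul, norm_smul, mul_pow, mul_pow, Real.norm_eq_abs, Real.norm_eq_abs, sq_abs,
    sq_abs, neg_sq, neg_sq] at h1
  have h3 : η ^ 2 * ‖g + e‖ ^ 2 ≤ (2 * β) ^ 2 * (2 * (‖g‖ ^ 2 + ‖e‖ ^ 2)) := by
    have := norm_add_sq_le_two_mul g e
    gcongr
  have h4 : 2 * ‖p‖ ^ 2 / t ^ 2 = 2 * ((1 / t) ^ 2 * ‖p‖ ^ 2) := by field_simp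
  rw [h4]
  linarith

lemma abs_inner_le_mul_add_div {c : ℝ} (hc : 0 < c) (g p : E) :
    |⟪g, p⟫| ≤ c * ‖g‖ ^ 2 + ‖p‖ ^ 2 / c := by
  have hc2 : ∀ s : ℝ, s ^ 2 = 1 → 0 ≤ c * ‖g‖ ^ 2 + s * ⟪g, p⟫ + ‖p‖ ^ 2 / c := by
    intro s hs
    have := young_inner_nonneg (X := 1 / c) (c := s) hc
      (by rw [mul_assoc, mul_one_div_cancel hc.ne', hs]; norm_num) g p
    rwa [one_div_mul_eq_div] at this
  rw [abs_le]
  constructor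
  · linarith [hc2 1 (by norm_num)]
  · linarith [hc2 (-1) (by norm_num)]

end Iteration

section Expectation

variable {Ω : Type*} {m0 : MeasurableSpace Ω} {ℙ : Measure Ω}

lemma sum_mul_integral_nonneg {ι : Type*} [Fintype ι] {f : ι → Ω → ℝ}
    (hf : ∀ i, Integrable (f i) ℙ) (c : ι → ℝ) (h : ∀ᵐ ω ∂ℙ, 0 ≤ ∑ i, c i * f i ω) :
    0 ≤ ∑ i, c i * ∫ ω, f i ω ∂ℙ := by
  have e : ∑ i, c i * ∫ ω, f i ω ∂ℙ = ∫ ω, ∑ i, c i * f i ω ∂ℙ := by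
    rw [integral_finsetSum _ fun i _ => (hf i).const_mul _]
    simp only [integral_const_mul]
  rw [e]
  exact integral_nonneg_of_ae h

lemma integral_le_of_condExp_le {m : MeasurableSpace Ω} (hm : m ≤ m0) [SigmaFinite (ℙ.trim hm)]
    {f g : Ω → ℝ} (hg : Integrable g ℙ) (h : ℙ[f|m] ≤ᵐ[ℙ] g) :
    ∫ ω, f ω ∂ℙ ≤ ∫ ω, g ω ∂ℙ := by
  rw [← integral_condExp hm]
  exact integral_mono_ae integrable_condExp hg h

lemma integrable_inner_of_memLp_two {E : Type*} [NormedAddCommGroup E] [InnerProductSpace ℝ E]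
    {f g : Ω → E} (hf : MemLp f 2 ℙ) (hg : MemLp g 2 ℙ) :
    Integrable (fun ω => ⟪f ω, g ω⟫) ℙ := by
  refine (((memLp_two_iff_integrable_sq_norm hf.1).1 hf).add
    ((memLp_two_iff_integrable_sq_norm hg.1).1 hg)).mono' (hf.1.inner hg.1)
    (Eventually.of_forall fun ω => ?_)
  have h := abs_real_inner_le_norm (f ω) (g ω)
  rw [Real.norm_eq_abs, Pi.add_apply]
  nlinarith [sq_nonneg (‖f ω‖ - ‖g ω‖), sq_nonneg ‖f ω‖, sq_nonneg ‖g ω‖]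

end Expectation

section ExpectedRates

variable {Ω : Type*} {m0 : MeasurableSpace Ω} {ℙ : Measure Ω}

lemma expected_rates_of_lyapunov_descent {μ r β Λ : ℝ} (hμ0 : 0 < μ) (hμ1 : μ < 2 / 3)
    (hr : 2 + 1 / μ ≤ r) (hβ : 0 < β) (hΛ : 0 ≤ Λ)
    {t A a C : ℕ → ℝ} (ht : ∀ k, t k = μ * ((k : ℝ) + r))
    (hA : ∀ k, A k = (t k - μ) * (t k - μ - 1))
    {γ P q W ε ee X : ℕ → Ω → ℝ} {D κ Θ σ Γ : ℕ → ℝ}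
    (iγ : ∀ k, Integrable (γ k) ℙ) (iP : ∀ k, Integrable (P k) ℙ)
    (iq : ∀ k, Integrable (q k) ℙ) (iW : ∀ k, Integrable (W k) ℙ)
    (iε : ∀ k, Integrable (ε k) ℙ) (iee : ∀ k, Integrable (ee k) ℙ)
    (iX : ∀ k, Integrable (X k) ℙ)
    (hγ : ∀ k ω, 0 ≤ γ k ω) (hee : ∀ k ω, 0 ≤ ee k ω) (hP : ∀ k ω, 0 ≤ P k ω)
    (hX0 : ∀ k ω, 0 ≤ X k ω) (hP0 : ∀ ω, P 0 ω = 0) (hq0 : ∀ ω, q 0 ω = 0)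
    (hΓ : ∀ k, 0 < Γ k) (hΘ : ∀ k, 0 < Θ k) (hε : ∀ k, ∀ᵐ ω ∂ℙ, 0 ≤ ε k ω)
    (hΓΘ : ∀ k, Γ k * Θ k ≤ 2 * Λ)
    (heD : ∀ k, ∫ ω, ee k ω ∂ℙ ≤ D k) (hD0 : D 0 ≤ σ 0 ^ 2)
    (hD : ∀ k, D (k + 1)
      ≤ (1 - κ (k + 1)) * D k + Θ (k + 1) * ∫ ω, ε (k + 1) ω ∂ℙ + σ (k + 1) ^ 2)
    (hκ : ∀ k, (1 - κ (k + 1)) * (Γ (k + 1) * A (k + 1)) ≤ Γ k * A k - 5 * β / μ * A (k + 1))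
    (hB : Summable fun k => A k * σ k ^ 2 / Θ k)
    (hV : ∀ k, ∀ᵐ ω ∂ℙ, β * t k * (t k - 1) * γ (k + 1) ω + t k * q (k + 1) ω
        + a (k + 1) * P (k + 1) ω + C (k + 1) * W (k + 1) ω
        + t k * (t k - 1) * (Λ * ε (k + 1) ω)
      ≤ β * (t k - μ) * (t k - μ - 1) * γ k ω + (t k - μ) * q k ω + a k * P k ω + C k * W k ω
        + 12 / 5 * β / μ * (t k * (t k - 1)) * ee k ω - β * (2 - 3 * μ) / 8 * t k * γ k ω)
    (hlow : ∀ k, ∀ᵐ ω ∂ℙ, β / 2 * (t k - μ) ^ 2 * γ k ω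
      ≤ β * (t k - μ) * (t k - μ - 1) * γ k ω + (t k - μ) * q k ω + a k * P k ω + C k * W k ω)
    (hU : ∀ k, ∀ᵐ ω ∂ℙ, β * t k * (t k - 1) * γ (k + 1) ω + t k * q (k + 1) ω
      ≤ β * (t k - μ) * (t k - μ - 1) * γ k ω + (t k - μ) * q k ω
        + (1 + 2 * μ * β + β) * (t k * γ k ω) + P k ω / t k
        + 2 * β / μ * (t k * (t k - 1) * ee k ω))
    (hPs : ∀ k, ∀ᵐ ω ∂ℙ,
      P (k + 1) ω + P k ω / t k ≤ P k ω + 8 * β ^ 2 * t k * (γ k ω + ee k ω))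
    (hX : ∀ k, ∀ᵐ ω ∂ℙ, X k ω ≤ 2 * P k ω / t k ^ 2 + 16 * β ^ 2 * (γ k ω + ee k ω))
    (hq : ∀ k (c : ℝ), 0 < c → ∀ ω, |q k ω| ≤ c * γ k ω + P k ω / c) :
    (∀ k, β / 2 * (t k - μ) ^ 2 * ∫ ω, γ k ω ∂ℙ
        ≤ β * A 0 * ∫ ω, γ 0 ω ∂ℙ + C 0 * ∫ ω, W 0 ω ∂ℙ + Λ * ∑' k, A k * σ k ^ 2 / Θ k)
    ∧ Summable (fun k : ℕ => ((k : ℝ) + 1) * ∫ ω, γ k ω ∂ℙ)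
    ∧ Summable (fun k : ℕ => ((k : ℝ) + 1) ^ 2 * ∫ ω, ee k ω ∂ℙ)
    ∧ Summable (fun k : ℕ => ((k : ℝ) + 1) * ∫ ω, X k ω ∂ℙ)
    ∧ Tendsto (fun k : ℕ => (k : ℝ) ^ 2 * ∫ ω, X k ω ∂ℙ) atTop (nhds 0)
    ∧ Tendsto (fun k : ℕ => (k : ℝ) ^ 2 * ∫ ω, γ k ω ∂ℙ) atTop (nhds 0) := by
  have hint : ∀ k (c : Fin 11 → ℝ), (∀ᵐ ω ∂ℙ, 0 ≤ c 0 * γ (k + 1) ω + c 1 * q (k + 1) ω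
      + c 2 * P (k + 1) ω + c 3 * W (k + 1) ω + c 4 * ε (k + 1) ω + c 5 * γ k ω + c 6 * q k ω
      + c 7 * P k ω + c 8 * W k ω + c 9 * ee k ω + c 10 * X k ω) →
      0 ≤ c 0 * ∫ ω, γ (k + 1) ω ∂ℙ + c 1 * ∫ ω, q (k + 1) ω ∂ℙ
      + c 2 * ∫ ω, P (k + 1) ω ∂ℙ + c 3 * ∫ ω, W (k + 1) ω ∂ℙ + c 4 * ∫ ω, ε (k + 1) ω ∂ℙ
      + c 5 * ∫ ω, γ k ω ∂ℙ + c 6 * ∫ ω, q k ω ∂ℙ + c 7 * ∫ ω, P k ω ∂ℙ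
      + c 8 * ∫ ω, W k ω ∂ℙ + c 9 * ∫ ω, ee k ω ∂ℙ + c 10 * ∫ ω, X k ω ∂ℙ := by
    intro k c h
    have := sum_mul_integral_nonneg (ℙ := ℙ)
      (f := ![γ (k + 1), q (k + 1), P (k + 1), W (k + 1), ε (k + 1), γ k, q k, P k, W k, ee k, X k])
      (fun i => by
        fin_cases i
        exacts [iγ _, iq _, iP _, iW _, iε _, iγ _, iq _, iP _, iW _, iee _, iX _]) c
      (h.mono fun ω hω => by
        refine hω.trans_eq ?_
        rw [Fin.sum_univ_castSucc, Fin.sum_univ_castSucc, Fin.sum_univ_castSucc,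
          Fin.sum_univ_eight]
        rfl)
    refine this.trans_eq ?_
    rw [Fin.sum_univ_castSucc, Fin.sum_univ_castSucc, Fin.sum_univ_castSucc,
      Fin.sum_univ_eight]
    rfl
  refine rates_of_lyapunov_descent hμ0 hμ1 hr hβ hΛ ht hA
    (γ := fun k => ∫ ω, γ k ω ∂ℙ) (P := fun k => ∫ ω, P k ω ∂ℙ) (q := fun k => ∫ ω, q k ω ∂ℙ)
    (W := fun k => ∫ ω, W k ω ∂ℙ) (ε := fun k => ∫ ω, ε k ω ∂ℙ) (ee := fun k => ∫ ω, ee k ω ∂ℙ)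
    (X := fun k => ∫ ω, X k ω ∂ℙ) (D := D) (a := a)
    (fun k => integral_nonneg (hγ k)) (fun k => integral_nonneg (hee k))
    (fun k => integral_nonneg (hP k)) (fun k => integral_nonneg (hX0 k))
    (by simp [hP0]) (by simp [hq0]) hΓ hΘ (fun k => integral_nonneg_of_ae (hε k)) hΓΘ heD hD0 hD hκ
    hB (fun k => ?_) (fun k => ?_) (fun k => ?_) (fun k => ?_) (fun k => ?_) fun k c hc => ?_
  · have := hint k ![-(β * t k * (t k - 1)), -t k, -a (k + 1), -C (k + 1),
      -(t k * (t k - 1) * Λ), β * (t k - μ) * (t k - μ - 1) - β * (2 - 3 * μ) / 8 * t k, t k - μ,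
      a k, C k, 12 / 5 * β / μ * (t k * (t k - 1)), 0] ((hV k).mono fun ω h => by
        simp only [Matrix.cons_val]
        linarith)
    simp only [Matrix.cons_val] at this
    linarith
  · have := hint k ![0, 0, 0, 0, 0,
      β * (t k - μ) * (t k - μ - 1) - β / 2 * (t k - μ) ^ 2, t k - μ,
      a k, C k, 0, 0] ((hlow k).mono fun ω h => by
        simp only [Matrix.cons_val]
        linarith)
    simp only [Matrix.cons_val] at this
    linarith
  · have := hint k ![-(β * t k * (t k - 1)), -t k, 0, 0, 0,
      β * (t k - μ) * (t k - μ - 1) + (1 + 2 * μ * β + β) * t k, t k - μ,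
      (t k)⁻¹, 0, 2 * β / μ * (t k * (t k - 1)), 0] ((hU k).mono fun ω h => by
        simp only [Matrix.cons_val, div_eq_mul_inv] at h ⊢
        linarith)
    simp only [Matrix.cons_val, div_eq_mul_inv] at this ⊢
    linarith
  · have := hint k ![0, 0, -1, 0, 0, 8 * β ^ 2 * t k, 0, 1 - (t k)⁻¹, 0, 8 * β ^ 2 * t k, 0]
      ((hPs k).mono fun ω h => by
        simp only [Matrix.cons_val, div_eq_mul_inv] at h ⊢
        linarith)
    simp only [Matrix.cons_val, div_eq_mul_inv] at this ⊢
    linarith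
  · have := hint k ![0, 0, 0, 0, 0, 16 * β ^ 2, 0, 2 * (t k ^ 2)⁻¹, 0, 16 * β ^ 2, -1]
      ((hX k).mono fun ω h => by
        simp only [Matrix.cons_val, div_eq_mul_inv] at h ⊢
        linarith)
    simp only [Matrix.cons_val, div_eq_mul_inv] at this ⊢
    linarith
  · have h1 := hint k ![0, 0, 0, 0, 0, c, 1, c⁻¹, 0, 0, 0]
      (Eventually.of_forall fun ω => by
        have h := neg_le_of_abs_le (hq k c hc ω)
        simp only [Matrix.cons_val, div_eq_mul_inv] at h ⊢
        linarith)
    have h2 := hint k ![0, 0, 0, 0, 0, c, -1, c⁻¹, 0, 0, 0]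
      (Eventually.of_forall fun ω => by
        have h := le_of_abs_le (hq k c hc ω)
        simp only [Matrix.cons_val, div_eq_mul_inv] at h ⊢
        linarith)
    simp only [Matrix.cons_val] at h1 h2
    rw [div_eq_mul_inv]
    exact abs_le.2 ⟨by linarith, by linarith⟩

end ExpectedRates

/-- `O(1/k²)` and `o(1/k²)` rates and summability bounds in expectation for VFOSA₊ under summable variance. -/
theorem stmt_14 (p : ℕ) (hp : 1 ≤ p)
    (L ρ Lhat lam μ r β : ℝ)
    (hL : 0 < L) (hρ : 0 ≤ ρ) (hLρ : L * ρ < 1)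
    (hLhat : L < Lhat) (hLhatρ : Lhat * ρ < 1)
    (hlam1 : 2 * ρ ≤ lam) (hlam2 : lam < 2 * (1 + Real.sqrt (1 - Lhat * ρ)) / Lhat)
    (hμ0 : 0 < μ) (hμ1 : μ < 2 / 3) (hr : r ≥ 2 + 1 / μ) (hβ0 : 0 < β)
    (F : EuclideanSpace ℝ (Fin p) → EuclideanSpace ℝ (Fin p))
    (hF : ∀ a b, ⟪F a - F b, a - b⟫ ≥ (1 / L) * ‖F a - F b‖ ^ 2)
    (T : EuclideanSpace ℝ (Fin p) → Set (EuclideanSpace ℝ (Fin p)))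
    (hT : ∀ a b u v, u ∈ T a → v ∈ T b → ⟪u - v, a - b⟫ ≥ -ρ * ‖u - v‖ ^ 2)
    (J : EuclideanSpace ℝ (Fin p) → EuclideanSpace ℝ (Fin p))
    (hJ : ∀ a, a - J a ∈ lam • T (J a))
    (G : EuclideanSpace ℝ (Fin p) → EuclideanSpace ℝ (Fin p))
    (hG : ∀ a, G a = (1 / lam) • (a - J (a - lam • F a)))
    (xstar : EuclideanSpace ℝ (Fin p)) (hxstar : G xstar = 0)
    (βbar Λ : ℝ)
    (hβbar : βbar = (lam * (4 - Lhat * lam) - 4 * ρ) / (4 * (1 - ρ * Lhat)))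
    (hΛ : Λ = (Lhat - L) / (L * Lhat))
    (hβub : β ≤ (2 - μ) * βbar / (2 + μ))
    {Ω : Type*} {m0 : MeasurableSpace Ω} (ℙ : Measure Ω) [IsProbabilityMeasure ℙ]
    (ℱ : Filtration ℕ m0)
    (x z y Gt Ft : ℕ → Ω → EuclideanSpace ℝ (Fin p))
    (hxmeas : ∀ k, StronglyMeasurable[ℱ k] (x k))
    (hzmeas : ∀ k, StronglyMeasurable[ℱ k] (z k))
    (hFtmeas : ∀ k, StronglyMeasurable[ℱ (k + 1)] (Ft k))
    (x0 : EuclideanSpace ℝ (Fin p)) (hx0 : ∀ ω, x 0 ω = x0) (hz0 : ∀ ω, z 0 ω = x0)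
    (hiter : ∀ᵐ ω ∂ℙ, ∀ k : ℕ,
      y k ω = (1 / (μ * ((k : ℝ) + r))) • ((μ * ((k : ℝ) + r) - 1) • x k ω + z k ω) ∧
      Gt k ω = (1 / lam) • (x k ω - J (x k ω - lam • Ft k ω)) ∧
      x (k + 1) ω = y k ω
        - (2 * β * (μ * ((k : ℝ) + r) - 1) / (μ * ((k : ℝ) + r) - μ / 2)) • Gt k ω ∧
      z (k + 1) ω = z k ω + (μ / 2) • (x (k + 1) ω - y k ω))
    (Δ Ebar : ℕ → Ω → ℝ) (κ Θ σ' : ℕ → ℝ)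
    (hΔmeas : ∀ k, StronglyMeasurable[ℱ (k + 1)] (Δ k))
    (hΔpos : ∀ k, ∀ᵐ ω ∂ℙ, 0 ≤ Δ k ω)
    (hEbarmeas : ∀ k, StronglyMeasurable[ℱ k] (Ebar k))
    (hEbarpos : ∀ k, ∀ᵐ ω ∂ℙ, 0 ≤ Ebar k ω)
    (hEbar0 : ∀ ω, Ebar 0 ω = 0)
    (hκ : ∀ k, 0 < κ k ∧ κ k ≤ 1) (hΘ : ∀ k, 0 < Θ k) (hσ : ∀ k, 0 ≤ σ' k)
    (hVR1 : ∀ k, ℙ[(fun ω => ‖Ft k ω - F (x k ω)‖ ^ 2)|ℱ k] ≤ᵐ[ℙ] ℙ[Δ k|ℱ k])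
    (hVR2 : ∀ k, ℙ[Δ k|ℱ k] ≤ᵐ[ℙ]
      fun ω => (1 - κ k) * (if k = 0 then 0 else Δ (k - 1) ω) + Θ k * Ebar k ω + σ' k ^ 2)
    (hEbarle : ∀ k, ∀ᵐ ω ∂ℙ,
      Ebar k ω ≤ L * ⟪F (x k ω) - F (x (k - 1) ω), x k ω - x (k - 1) ω⟫)
    (hint1 : ∀ k, Integrable (fun ω => ‖G (x k ω)‖ ^ 2) ℙ)
    (hint2 : ∀ k, Integrable (fun ω => ‖Ft k ω - F (x k ω)‖ ^ 2) ℙ)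
    (hint3 : ∀ k, Integrable (Δ k) ℙ)
    (hint4 : ∀ k, Integrable (Ebar k) ℙ)
    (hint5 : ∀ k, Integrable (fun ω => ‖z k ω - xstar‖ ^ 2) ℙ)
    (Γ : ℕ → ℝ) (hΓ : ∀ k, 0 < Γ k)
    (hΓcond : ∀ k : ℕ, 1 ≤ k →
      κ k ≥ 1 - Γ (k - 1) * (μ * ((k : ℝ) + r - 2)) * (μ * ((k : ℝ) + r - 2) - 1)
          / (Γ k * (μ * ((k : ℝ) + r - 1)) * (μ * ((k : ℝ) + r - 1) - 1))
        + 5 * β / (μ * Γ k))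
    (hΓΘ : ∀ k, Γ k * Θ k ≤ 2 * Λ)

    (hβstrict : β < (2 - μ) * βbar / (2 + μ))
    (hBsum : Summable (fun k : ℕ =>
      (μ * ((k : ℝ) + r - 1)) * (μ * ((k : ℝ) + r - 1) - 1) * σ' k ^ 2 / Θ k)) :
    (∀ k : ℕ, ∫ ω, ‖G (x k ω)‖ ^ 2 ∂ℙ
        ≤ 2 * ((μ ^ 2 * r ^ 2 * ‖G x0‖ ^ 2 + (2 * r - 1) / (4 * β ^ 2 * (μ * r - 1)) * ‖x0 - xstar‖ ^ 2) + (μ * r ^ 2 * (Γ 0 * μ + β) / (2 * β) * σ' 0 ^ 2) + ((Λ / β) * ∑' k : ℕ, (μ * ((k : ℝ) + r - 1)) * (μ * ((k : ℝ) + r - 1) - 1) * σ' k ^ 2 / Θ k)) / (μ ^ 2 * ((k : ℝ) + r - 1) ^ 2))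
    ∧ Summable (fun k : ℕ => ((k : ℝ) + 1) * ∫ ω, ‖G (x k ω)‖ ^ 2 ∂ℙ)
    ∧ Summable (fun k : ℕ => ((k : ℝ) + 1) ^ 2 * ∫ ω, ‖Ft k ω - F (x k ω)‖ ^ 2 ∂ℙ)
    ∧ Summable (fun k : ℕ => ((k : ℝ) + 1) * ∫ ω, ‖x (k + 1) ω - x k ω‖ ^ 2 ∂ℙ)
    ∧ Tendsto (fun k : ℕ => (k : ℝ) ^ 2 * ∫ ω, ‖x (k + 1) ω - x k ω‖ ^ 2 ∂ℙ) atTop (nhds 0)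
    ∧ Tendsto (fun k : ℕ => (k : ℝ) ^ 2 * ∫ ω, ‖G (x k ω)‖ ^ 2 ∂ℙ) atTop (nhds 0) := by
  have hLh : 0 < Lhat := hL.trans hLhat
  have hμ2 : 0 < 2 - μ := by linarith
  have hΛ0 : 0 < Λ := hΛ ▸ div_pos (sub_pos.2 hLhat) (mul_pos hL hLh)
  have hβμ : (2 + μ) / (2 - μ) * β ≤ βbar := by
    rw [le_div_iff₀ (by linarith)] at hβub
    rw [div_mul_eq_mul_div, div_le_iff₀ hμ2]
    linarith
  have hββbar : β ≤ βbar := by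
    refine le_trans ?_ hβμ
    exact le_mul_of_one_le_left hβ0.le ((one_le_div hμ2).2 (by linarith))
  have hβbar0 : 0 < βbar := hβ0.trans_le hββbar
  have hlam : 0 < lam := by
    refine lt_of_le_of_ne (by linarith) fun h => hβbar0.ne' ?_
    have hρ0 : ρ = 0 := by linarith
    rw [hβbar, ← h, hρ0]
    simp
  have hmon : ∀ u v, 0 ≤ L * ⟪F u - F v, u - v⟫ := fun u v =>
    mul_nonneg hL.le (le_trans (by positivity) (hF u v))
  have hco : ∀ u v, βbar * ‖G u - G v‖ ^ 2 + Λ * (L * ⟪F u - F v, u - v⟫)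
      ≤ ⟪G u - G v, u - v⟫ := by
    rw [hβbar, hΛ]
    exact forwardBackward_cocoercive hL hLhat hLhatρ hlam hF hT hJ hG
  have hGstar : ∀ u, βbar * ‖G u‖ ^ 2 ≤ ⟪G u, u - xstar⟫ := fun u => by
    have h := hco u xstar
    rw [hxstar, sub_zero] at h
    linarith [mul_nonneg hΛ0.le (hmon u xstar)]
  have hGcont : Continuous G := by
    have hlip := cocoercive_lipschitz (F := G) (one_div_pos.2 hβbar0) fun u v => by
      rw [one_div_one_div]
      linarith [hco u v, mul_nonneg hΛ0.le (hmon u v)]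
    exact (LipschitzWith.of_dist_le' fun u v => by
      simpa only [dist_eq_norm] using hlip u v).continuous
  have hμr : 1 + 2 * μ ≤ μ * r := by
    have := mul_le_mul_of_nonneg_left hr hμ0.le
    rw [mul_add, mul_one_div_cancel hμ0.ne'] at this
    linarith
  set t : ℕ → ℝ := fun k => μ * ((k : ℝ) + r) with htdef
  have ht1 : ∀ k, 1 + 2 * μ ≤ t k := fun k => by
    have : 0 ≤ μ * (k : ℝ) := by positivity
    simp only [htdef]
    linarith
  have htpos : ∀ k, 0 < t k := fun k => by linarith [ht1 k]
  have hts : ∀ k, t (k + 1) = t k + μ := fun k => by simp only [htdef]; push_cast; ring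
  set η : ℕ → ℝ := fun k => 2 * β * (t k - 1) / (t k - μ / 2) with hη
  have hη0 : ∀ k, 0 < η k := fun k => (step_size_bounds hμ0 hμ1 hβ0 (ht1 k)).1
  have hη2 : ∀ k, η k ≤ 2 * β := fun k => (step_size_bounds hμ0 hμ1 hβ0 (ht1 k)).2
  set A : ℕ → ℝ := fun k => (t k - μ) * (t k - μ - 1) with hA
  have hAs : ∀ k, A (k + 1) = t k * (t k - 1) := fun k => by
    simp only [hA, hts, add_sub_cancel_right]
  have hApos : ∀ k, 0 < A k := fun k =>
    mul_pos (by linarith [ht1 k]) (by linarith [ht1 k])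
  have hAeq : ∀ k : ℕ, A k = μ * ((k : ℝ) + r - 1) * (μ * ((k : ℝ) + r - 1) - 1) := fun k => by
    simp only [hA, htdef]; ring
  set a : ℕ → ℝ := fun k => μ * t k * (2 * t k - μ) / (4 * β * (2 - μ) * (t k - 1) ^ 2) with ha
  set C : ℕ → ℝ := fun k => (2 * t k - μ) / (4 * μ * β * (t k - 1)) with hC
  have hstep : ∀ᵐ ω ∂ℙ, ∀ k, (t k - 1) • (x (k + 1) ω - x k ω)
        = -(x (k + 1) ω - z (k + 1) ω) - (2 * β * (t k - 1)) • Gt k ω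
      ∧ t k • (x (k + 1) ω - x k ω) = -(x k ω - z k ω) - (t k * η k) • Gt k ω
      ∧ x (k + 1) ω - z (k + 1) ω
        = ((t k - 1) / t k) • (x k ω - z k ω) - ((1 - μ / 2) * η k) • Gt k ω
      ∧ ∀ u, z (k + 1) ω - u = (z k ω - u) - (μ / 2 * η k) • Gt k ω := by
    filter_upwards [hiter] with ω hω k
    obtain ⟨h1, -, h3, h4⟩ := hω k
    exact anchored_step_identities (htpos k).ne' (by linarith [ht1 k]) rfl h1 h3 h4
  have herr : ∀ᵐ ω ∂ℙ, ∀ k, ‖Gt k ω - G (x k ω)‖ ^ 2 ≤ ‖Ft k ω - F (x k ω)‖ ^ 2 := by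
    filter_upwards [hiter] with ω hω k
    refine pow_le_pow_left₀ (norm_nonneg _) ?_ 2
    have h := resolvent_nonexpansive hlam hlam1 hT hJ (x k ω - lam • F (x k ω))
      (x k ω - lam • Ft k ω)
    have e : x k ω - lam • F (x k ω) - (x k ω - lam • Ft k ω)
        = lam • (Ft k ω - F (x k ω)) := by module
    rw [e, norm_smul, Real.norm_of_nonneg hlam.le] at h
    rw [(hω k).2.1, hG, ← smul_sub, sub_sub_sub_cancel_left, norm_smul,
      Real.norm_of_nonneg (one_div_pos.2 hlam).le, one_div, inv_mul_le_iff₀ hlam]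
    exact h
  have hxm : ∀ k, AEStronglyMeasurable (x k) ℙ := fun k =>
    ((hxmeas k).mono (ℱ.le k)).aestronglyMeasurable
  have hzm : ∀ k, AEStronglyMeasurable (z k) ℙ := fun k =>
    ((hzmeas k).mono (ℱ.le k)).aestronglyMeasurable
  have hw2 : ∀ k, MemLp (fun ω => z k ω - xstar) 2 ℙ := fun k =>
    (memLp_two_iff_integrable_sq_norm ((hzm k).sub aestronglyMeasurable_const)).2 (hint5 k)
  have hg2 : ∀ k, MemLp (fun ω => G (x k ω)) 2 ℙ := fun k =>
    (memLp_two_iff_integrable_sq_norm (hGcont.comp_aestronglyMeasurable (hxm k))).2 (hint1 k)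
  have hGt2 : ∀ k, MemLp (Gt k) 2 ℙ := fun k => by
    have h := ((hw2 k).sub (hw2 (k + 1))).const_smul (μ / 2 * η k)⁻¹
    refine h.ae_eq ?_
    filter_upwards [hstep] with ω hω
    have h0 : μ / 2 * η k ≠ 0 := (mul_pos (half_pos hμ0) (hη0 k)).ne'
    simp only [Pi.smul_apply, Pi.sub_apply]
    rw [(hω k).2.2.2 xstar, sub_sub_cancel, inv_smul_smul₀ h0]
  have hp2 : ∀ k, MemLp (fun ω => x k ω - z k ω) 2 ℙ := by
    intro k
    induction k with
    | zero =>
      refine (memLp_const (0 : EuclideanSpace ℝ (Fin p))).ae_eq (Eventually.of_forall fun ω => ?_)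
      simp only [hx0, hz0, sub_self]
    | succ k ih =>
      refine ((ih.const_smul ((t k - 1) / t k)).sub
        ((hGt2 k).const_smul ((1 - μ / 2) * η k))).ae_eq ?_
      filter_upwards [hstep] with ω hω
      exact (hω k).2.2.1.symm
  have hd2 : ∀ k, MemLp (fun ω => x (k + 1) ω - x k ω) 2 ℙ := by
    intro k
    refine (((hp2 (k + 1)).add (hw2 (k + 1))).sub ((hp2 k).add (hw2 k))).ae_eq
      (Eventually.of_forall fun ω => ?_)
    simp only [Pi.sub_apply, Pi.add_apply]
    abel
  have hP : ∀ k, Integrable (fun ω => ‖x k ω - z k ω‖ ^ 2) ℙ := fun k =>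
    (memLp_two_iff_integrable_sq_norm (hp2 k).1).1 (hp2 k)
  have hX : ∀ k, Integrable (fun ω => ‖x (k + 1) ω - x k ω‖ ^ 2) ℙ := fun k =>
    (memLp_two_iff_integrable_sq_norm (hd2 k).1).1 (hd2 k)
  have hDerr : ∀ k, ∫ ω, ‖Ft k ω - F (x k ω)‖ ^ 2 ∂ℙ ≤ ∫ ω, Δ k ω ∂ℙ := fun k =>
    (integral_le_of_condExp_le (ℱ.le k) integrable_condExp (hVR1 k)).trans_eq
      (integral_condExp (ℱ.le k))
  have hD0 : ∫ ω, Δ 0 ω ∂ℙ ≤ σ' 0 ^ 2 := by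
    have h := hVR2 0
    simp only [hEbar0, if_true, mul_zero, zero_add] at h
    simpa using integral_le_of_condExp_le (ℱ.le 0) (integrable_const _) h
  have hDs : ∀ k, ∫ ω, Δ (k + 1) ω ∂ℙ ≤ (1 - κ (k + 1)) * ∫ ω, Δ k ω ∂ℙ
      + Θ (k + 1) * ∫ ω, Ebar (k + 1) ω ∂ℙ + σ' (k + 1) ^ 2 := by
    intro k
    have h := hVR2 (k + 1)
    simp only [Nat.succ_ne_zero, if_false, add_tsub_cancel_right] at h
    have i1 := (hint3 k).const_mul (1 - κ (k + 1))
    have i2 := (hint4 (k + 1)).const_mul (Θ (k + 1))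
    refine (integral_le_of_condExp_le (ℱ.le (k + 1))
      ((i1.add i2).add (integrable_const _)) h).trans_eq ?_
    rw [integral_add' (i1.add i2) (integrable_const _), integral_add' i1 i2, integral_const_mul,
      integral_const_mul]
    simp
  have hκA : ∀ k, (1 - κ (k + 1)) * (Γ (k + 1) * A (k + 1))
      ≤ Γ k * A k - 5 * β / μ * A (k + 1) := by
    intro k
    have h := hΓcond (k + 1) (Nat.succ_pos k)
    have e1 : μ * (((k + 1 : ℕ) : ℝ) + r - 2) = t k - μ := by simp only [htdef]; push_cast; ring
    have e2 : μ * (((k + 1 : ℕ) : ℝ) + r - 1) = t k := by simp only [htdef]; push_cast; ring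
    rw [e1, e2, Nat.add_sub_cancel, mul_assoc (Γ k), mul_assoc (Γ (k + 1)), ← hAs] at h
    have hΓA := mul_pos (hΓ (k + 1)) (hApos (k + 1))
    have h' : 1 - κ (k + 1) ≤ Γ k * A k / (Γ (k + 1) * A (k + 1)) - 5 * β / (μ * Γ (k + 1)) := by
      linarith
    refine (mul_le_mul_of_nonneg_right h' hΓA.le).trans_eq ?_
    have := (hΓ (k + 1)).ne'
    have := (hApos (k + 1)).ne'
    field_simp
  have hB : Summable fun k => A k * σ' k ^ 2 / Θ k := by
    simpa only [hAeq] using hBsum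
  have hpw : ∀ (k : ℕ) ω, (x k ω - z k ω) + (z k ω - xstar) = x k ω - xstar := fun k ω =>
    sub_add_sub_cancel _ _ _
  have hinc : ∀ k, ∀ᵐ ω ∂ℙ, βbar * ‖G (x (k + 1) ω) - G (x k ω)‖ ^ 2 + Λ * Ebar (k + 1) ω
      ≤ ⟪G (x (k + 1) ω) - G (x k ω), x (k + 1) ω - x k ω⟫ := by
    intro k
    filter_upwards [hEbarle (k + 1)] with ω h
    rw [Nat.add_sub_cancel] at h
    linarith [hco (x (k + 1) ω) (x k ω), mul_le_mul_of_nonneg_left h hΛ0.le]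
  have hGte : ∀ k ω, Gt k ω = G (x k ω) + (Gt k ω - G (x k ω)) := fun k ω =>
    (add_sub_cancel _ _).symm
  obtain ⟨hbound, hrest⟩ := expected_rates_of_lyapunov_descent (ℙ := ℙ) hμ0 hμ1 hr hβ0 hΛ0.le
    (t := t) (A := A) (a := a) (C := C) (κ := κ) (Θ := Θ) (Γ := Γ) (σ := σ')
    (γ := fun k ω => ‖G (x k ω)‖ ^ 2) (P := fun k ω => ‖x k ω - z k ω‖ ^ 2)
    (q := fun k ω => ⟪G (x k ω), x k ω - z k ω⟫) (W := fun k ω => ‖z k ω - xstar‖ ^ 2)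
    (ε := Ebar) (ee := fun k ω => ‖Ft k ω - F (x k ω)‖ ^ 2)
    (X := fun k ω => ‖x (k + 1) ω - x k ω‖ ^ 2) (D := fun k => ∫ ω, Δ k ω ∂ℙ)
    (fun _ => rfl) (fun _ => rfl) hint1 hP
    (fun k => integrable_inner_of_memLp_two (hg2 k) (hp2 k)) hint5 hint4 hint2 hX
    (fun _ _ => sq_nonneg _) (fun _ _ => sq_nonneg _) (fun _ _ => sq_nonneg _)
    (fun _ _ => sq_nonneg _) (fun ω => by simp [hx0, hz0]) (fun ω => by simp [hx0, hz0])
    hΓ hΘ hEbarpos hΓΘ hDerr hD0 hDs hκA hB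
    (fun k => by
      filter_upwards [hstep, herr, hinc k] with ω hω he hi
      obtain ⟨h1, h2, h3, h4⟩ := hω k
      rw [hGte] at h1 h2 h3
      have h4' := h4 xstar
      rw [hGte] at h4'
      have h := lyapunov_step hμ0 hμ1 hβ0 hβμ (ht1 k) rfl rfl (a' := a (k + 1))
        (by simpa only [ha, hts] using shift_weight_antitone hμ0 hμ1 hβ0 (ht1 k)) rfl
        (C' := C (k + 1)) (by simp only [hC, hts]) h1 h2 h3 h4' hi
        (by rw [hpw]; exact hGstar _)
      have hc : 0 ≤ 12 / 5 * β / μ * (t k * (t k - 1)) :=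
        mul_nonneg (by positivity) (hAs k ▸ hApos (k + 1)).le
      linarith [mul_le_mul_of_nonneg_left (he k) hc])
    (fun k => Eventually.of_forall fun ω => by
      have h1 := ht1 k
      have h2 : 0 < t k - 1 := by linarith
      have h3 : 0 < 2 * t k - μ := by linarith
      refine lyapunov_lower_bound hμ0 hμ1 hβ0 hββbar (by linarith) ?_ ?_
        (by rw [hpw]; exact hGstar _)
      · have := htpos k
        positivity
      · rw [div_le_div_iff₀ (by positivity) (by positivity)]
        have : 0 ≤ 2 * (μ * β) * (2 - μ) := by positivity
        linarith)
    (fun k => by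
      filter_upwards [hstep, herr, hinc k, hEbarpos (k + 1)] with ω hω he hi hε
      obtain ⟨h1, h2, -, -⟩ := hω k
      rw [hGte] at h1 h2
      have h := correlation_step_crude hμ0 hμ1 hβ0 hβμ (ht1 k) rfl (mul_nonneg hΛ0.le hε)
        h1 h2 hi
      have hc : 0 ≤ 2 * β / μ * (t k * (t k - 1)) :=
        mul_nonneg (by positivity) (hAs k ▸ hApos (k + 1)).le
      linarith [mul_le_mul_of_nonneg_left (he k) hc])
    (fun k => by
      filter_upwards [hstep, herr] with ω hω he
      obtain ⟨-, -, h3, -⟩ := hω k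
      rw [hGte] at h3
      have h := anchor_gap_descent (β := β) (by linarith [ht1 k])
        (mul_nonneg (by linarith) (hη0 k).le)
        ((mul_le_of_le_one_left (hη0 k).le (by linarith)).trans (hη2 k)) h3
      have hc : 0 ≤ 8 * β ^ 2 * t k := mul_nonneg (by positivity) (htpos k).le
      linarith [mul_le_mul_of_nonneg_left (he k) hc])
    (fun k => by
      filter_upwards [hstep, herr] with ω hω he
      obtain ⟨-, h2, -, -⟩ := hω k
      rw [hGte] at h2
      have h := increment_norm_sq_le (htpos k) (hη0 k).le (hη2 k) h2
      have hc : 0 ≤ 16 * β ^ 2 := by positivity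
      linarith [mul_le_mul_of_nonneg_left (he k) hc])
    (fun k c hc ω => abs_inner_le_mul_add_div hc _ _)
  refine ⟨fun k => ?_, hrest⟩
  have hk := hbound k
  simp only [hx0, hz0, integral_const, probReal_univ, one_smul] at hk
  simp only [← hAeq]
  have e1 : t k - μ = μ * ((k : ℝ) + r - 1) := by simp only [htdef]; ring
  have hk1 : 0 < μ * ((k : ℝ) + r - 1) := by linarith [ht1 k]
  have hr1 : 0 < μ * r - 1 := by linarith
  have hA0 : A 0 ≤ μ ^ 2 * r ^ 2 := by
    have : A 0 = μ ^ 2 * r ^ 2 - (2 * μ * (μ * r) + (μ * r - μ ^ 2 - μ)) := by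
      simp only [hA, htdef]; push_cast; ring
    nlinarith
  have hC0 : C 0 = β * ((2 * r - 1) / (4 * β ^ 2 * (μ * r - 1))) := by
    simp only [hC, htdef, Nat.cast_zero, zero_add]
    field_simp
  have hE0 : 0 ≤ μ * r ^ 2 * (Γ 0 * μ + β) / (2 * β) * σ' 0 ^ 2 := by
    have := hΓ 0
    positivity
  rw [e1] at hk
  rw [← mul_pow μ ((k : ℝ) + r - 1), le_div_iff₀ (pow_pos hk1 2)]
  rw [hC0] at hk
  have h1 := mul_le_mul_of_nonneg_right (mul_le_mul_of_nonneg_left hA0 hβ0.le)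
    (sq_nonneg ‖G x0‖)
  have h2 : β * (Λ / β * ∑' k, A k * σ' k ^ 2 / Θ k) = Λ * ∑' k, A k * σ' k ^ 2 / Θ k := by
    field_simp
  refine le_of_mul_le_mul_left ?_ (half_pos hβ0)
  linarith [mul_nonneg hβ0.le hE0]
end

section
/- Let (Ξ, 𝒢, ν) be a probability space, p ≥ 1, and let Φ₁, Φ₂, Φ₃ : Ξ → ℝ^p be measurable with ∫‖Φᵢ‖² dν < ∞ (i = 1,2,3). Let 𝐩 ∈ (0,1], α ∈ (0,1), and 0 < b' ≤ b be real numbers. Then (𝐩/b)·∫‖Φ₁ − Φ₂‖² dν + ((1 − 𝐩)/b)·∫‖Φ₁ − Φ₃‖² dν ≤ (1 − α𝐩)·(1/b')·∫‖Φ₂ − Φ₃‖² dν + (1/((1 − α)·b·𝐩))·∫‖Φ₁ − Φ₂‖² dν. -/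
open MeasureTheory

/-- A weighted Young inequality: if `d ≤ a + c`, then a convex combination of `a ^ 2` and `d ^ 2`
with weights `P` and `1 - P` is controlled by `c ^ 2` with a coefficient at most `1 - α * P`. -/
lemma convex_combination_sq_le {P α a c d : ℝ} (hP0 : 0 < P) (hP1 : P ≤ 1) (hα0 : 0 ≤ α)
    (hα1 : α < 1) (hd0 : 0 ≤ d) (hd : d ≤ a + c) :
    P * a ^ 2 + (1 - P) * d ^ 2 ≤ (1 - α * P) * c ^ 2 + 1 / ((1 - α) * P) * a ^ 2 := by
  have hq : 0 < (1 - α) * P := mul_pos (by linarith) hP0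
  have hd2 : d ^ 2 ≤ (a + c) ^ 2 := pow_le_pow_left₀ hd0 hd 2
  have hmono : (1 - P) * d ^ 2 ≤ (1 - P) * (a + c) ^ 2 :=
    mul_le_mul_of_nonneg_left hd2 (by linarith)
  have hcoef : 0 ≤ 1 - (1 - α) * P - (1 - P) ^ 2 := by
    nlinarith [mul_nonneg hα0 hP0.le, mul_nonneg hP0.le (sub_nonneg.2 hP1)]
  have hid : (1 - α * P) * c ^ 2 + 1 / ((1 - α) * P) * a ^ 2
      - (P * a ^ 2 + (1 - P) * (a + c) ^ 2)
      = (((1 - α) * P * c - (1 - P) * a) ^ 2 + a ^ 2 * (1 - (1 - α) * P - (1 - P) ^ 2))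
        / ((1 - α) * P) := by
    have h1α : 1 - α ≠ 0 := by linarith
    field_simp
    ring
  have hnonneg : 0 ≤ (((1 - α) * P * c - (1 - P) * a) ^ 2
      + a ^ 2 * (1 - (1 - α) * P - (1 - P) ^ 2)) / ((1 - α) * P) := by positivity
  linarith

/-- The difference of two square-integrable functions is square-integrable. -/
lemma integrable_norm_sub_sq {Ω E : Type*} [MeasurableSpace Ω] {μ : Measure Ω}
    [NormedAddCommGroup E] {f g : Ω → E} (hf : AEStronglyMeasurable f μ)
    (hg : AEStronglyMeasurable g μ) (hf2 : Integrable (fun ω => ‖f ω‖ ^ 2) μ)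
    (hg2 : Integrable (fun ω => ‖g ω‖ ^ 2) μ) :
    Integrable (fun ω => ‖f ω - g ω‖ ^ 2) μ :=
  (memLp_two_iff_integrable_sq_norm (hf.sub hg)).1
    (((memLp_two_iff_integrable_sq_norm hf).2 hf2).sub
      ((memLp_two_iff_integrable_sq_norm hg).2 hg2))

/-- One-step recursion bound for the Loopless-SVRG estimator. -/
theorem stmt_18 (p : ℕ) (hp : 1 ≤ p)
    {Ξ : Type*} [MeasurableSpace Ξ] (ν : Measure Ξ) [IsProbabilityMeasure ν]
    (Φ₁ Φ₂ Φ₃ : Ξ → EuclideanSpace ℝ (Fin p))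
    (hΦ₁ : Measurable Φ₁) (hΦ₂ : Measurable Φ₂) (hΦ₃ : Measurable Φ₃)
    (h1 : Integrable (fun ξ => ‖Φ₁ ξ‖ ^ 2) ν)
    (h2 : Integrable (fun ξ => ‖Φ₂ ξ‖ ^ 2) ν)
    (h3 : Integrable (fun ξ => ‖Φ₃ ξ‖ ^ 2) ν)
    (P α b b' : ℝ) (hP0 : 0 < P) (hP1 : P ≤ 1) (hα0 : 0 < α) (hα1 : α < 1)
    (hb' : 0 < b') (hbb : b' ≤ b) :
    (P / b) * ∫ ξ, ‖Φ₁ ξ - Φ₂ ξ‖ ^ 2 ∂ν + ((1 - P) / b) * ∫ ξ, ‖Φ₁ ξ - Φ₃ ξ‖ ^ 2 ∂ν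
      ≤ (1 - α * P) * (1 / b') * ∫ ξ, ‖Φ₂ ξ - Φ₃ ξ‖ ^ 2 ∂ν
        + (1 / ((1 - α) * b * P)) * ∫ ξ, ‖Φ₁ ξ - Φ₂ ξ‖ ^ 2 ∂ν := by
  have i12 := integrable_norm_sub_sq hΦ₁.aestronglyMeasurable hΦ₂.aestronglyMeasurable h1 h2
  have i13 := integrable_norm_sub_sq hΦ₁.aestronglyMeasurable hΦ₃.aestronglyMeasurable h1 h3
  have i23 := integrable_norm_sub_sq hΦ₂.aestronglyMeasurable hΦ₃.aestronglyMeasurable h2 h3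
  have key := integral_mono ((i12.const_mul P).add (i13.const_mul (1 - P)))
    ((i23.const_mul (1 - α * P)).add (i12.const_mul (1 / ((1 - α) * P))))
    fun ξ => convex_combination_sq_le hP0 hP1 hα0.le hα1 (norm_nonneg (Φ₁ ξ - Φ₃ ξ))
      (norm_sub_le_norm_sub_add_norm_sub (Φ₁ ξ) (Φ₂ ξ) (Φ₃ ξ))
  simp only [Pi.add_apply] at key
  rw [integral_add (i12.const_mul P) (i13.const_mul (1 - P)),
    integral_add (i23.const_mul (1 - α * P)) (i12.const_mul (1 / ((1 - α) * P)))] at key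
  simp only [integral_const_mul] at key
  have hC : 0 ≤ ∫ ξ, ‖Φ₂ ξ - Φ₃ ξ‖ ^ 2 ∂ν := integral_nonneg fun ξ => by positivity
  generalize ∫ ξ, ‖Φ₁ ξ - Φ₂ ξ‖ ^ 2 ∂ν = A at *
  generalize ∫ ξ, ‖Φ₁ ξ - Φ₃ ξ‖ ^ 2 ∂ν = D at *
  generalize ∫ ξ, ‖Φ₂ ξ - Φ₃ ξ‖ ^ 2 ∂ν = C at *
  have hb : 0 < b := hb'.trans_le hbb
  have h1α : 1 - α ≠ 0 := by linarith
  have hαP : 0 ≤ 1 - α * P := by nlinarith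
  calc P / b * A + (1 - P) / b * D = (P * A + (1 - P) * D) / b := by ring
    _ ≤ ((1 - α * P) * C + 1 / ((1 - α) * P) * A) / b := by gcongr
    _ = (1 - α * P) * (1 / b) * C + 1 / ((1 - α) * b * P) * A := by field_simp
    _ ≤ (1 - α * P) * (1 / b') * C + 1 / ((1 - α) * b * P) * A := by gcongr
end
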